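/- arXiv:1807.08052 — 5 statements merged into one kernel-verified Lean document; each statement's English description precedes it below -/
import Mathlib

section
/- Assume hypotheses (H1)–(H6), and let δ_G := ∏_{i=1}^m deg G_i (product of the total degrees). If q > 15·δ_G^{13/3} (as real numbers, i.e. q³ > 15³·δ_G^{13}), then the cardinality |A| of the family A satisfies, as real numbers: |A| ≥ q^{r−m}·(1 − 3·δ_G^{13/6}·q^{−1/2}), |A|^{−1} ≤ q^{m−r}·(1 + 15·δ_G^{13/6}·q^{−1/2}), and in particular |A| ≥ q^{r−m}/2. -/
open MvPolynomial Polynomial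
open scoped Classical

noncomputable section

/-- The monic polynomial `T^r + a_{r-1} T^{r-1} + ⋯ + a_0` attached to a coefficient
vector `a : Fin r → K` (where `a j` is the coefficient of `T^j`). -/
def monicOfCoeffs {K : Type*} [CommRing K] (r : ℕ) (a : Fin r → K) : Polynomial K :=
  Polynomial.X ^ r + ∑ j : Fin r, Polynomial.C (a j) * Polynomial.X ^ (j : ℕ)

/-- The vanishing ideal of a subset `Z ⊆ K^r`. -/
def vanishingIdealOf (K : Type*) [CommRing K] (r : ℕ) (Z : Set (Fin r → K)) :
    Ideal (MvPolynomial (Fin r) K) where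
  carrier := {p | ∀ x ∈ Z, MvPolynomial.eval x p = 0}
  add_mem' := by
    intro a b ha hb x hx
    simp [map_add, ha x hx, hb x hx]
  zero_mem' := by intro x hx; simp
  smul_mem' := by
    intro c p hp x hx
    simp [smul_eq_mul, map_mul, hp x hx]

/-- The dimension of a subset `Z ⊆ K^r`: the Krull dimension of the quotient of the
polynomial ring over `K` by the vanishing ideal of `Z`. -/
def dimOf (K : Type*) [CommRing K] (r : ℕ) (Z : Set (Fin r → K)) : WithBot ℕ∞ :=
  ringKrullDim (MvPolynomial (Fin r) K ⧸ vanishingIdealOf K r Z)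

/-- `f` has factorization pattern `λ = (λ_1, …, λ_r)`: for each `i`, exactly `λ_i` of the
monic irreducible factors of `f` over `F_q` (counted with multiplicity) have degree `i`.
(The index `i : Fin r` corresponds to the degree `i + 1`.) -/
def HasFactorizationPattern {Fq : Type*} [Field Fq] {r : ℕ}
    (f : Polynomial Fq) (lam : Fin r → ℕ) : Prop :=
  ∀ i : Fin r,
    ((UniqueFactorizationMonoid.normalizedFactors f).filter
      (fun g => g.natDegree = (i : ℕ) + 1)).card = lam i

end

section WeightedTriangular

variable {σ F : Type*}

/-- A weighted-homogeneous component, for positive weights, with nonzero constant coefficient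
is a nonzero constant, hence a unit. -/
theorem isUnit_weightedHomogeneousComponent_of_constantCoeff_ne_zero [Field F] {w : σ → ℕ}
    (hw : ∀ j, w j ≠ 0) {n : ℕ} {p : MvPolynomial σ F}
    (h : constantCoeff (weightedHomogeneousComponent w n p) ≠ 0) :
    IsUnit (weightedHomogeneousComponent w n p) := by
  have hn : n = 0 := by
    by_contra hn
    apply h
    rw [constantCoeff_eq, coeff_weightedHomogeneousComponent, if_neg]
    simpa using Ne.symm hn
  subst hn
  haveI := Finsupp.nonTorsionWeight_of (R := ℕ) w hw
  rw [weightedHomogeneousComponent_zero p hw] at h ⊢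
  exact (isUnit_iff_ne_zero.mpr (by simpa using h)).map MvPolynomial.C

/-- If every monomial of `p` has weight at most the weight of the variable `X s`, then `X s`
occurs in `p` only through its linear monomial, and no variable of larger weight occurs. -/
theorem eval_eq_linear_add_eval_lower_weight [Fintype σ] [CommRing F] {w : σ → ℕ}
    (hw : ∀ j, w j ≠ 0) (hinj : Function.Injective w) {s : σ} {p : MvPolynomial σ F}
    (hp : weightedTotalDegree w p ≤ w s) (a : σ → F) :
    MvPolynomial.eval a p = MvPolynomial.coeff (Finsupp.single s 1) p * a s
      + MvPolynomial.eval (fun j => if w j < w s then a j else 0) p := by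
  have key : ∀ d ∈ p.support, MvPolynomial.coeff d p * ∏ j, a j ^ d j =
      (if d = Finsupp.single s 1 then MvPolynomial.coeff (Finsupp.single s 1) p * a s else 0)
      + MvPolynomial.coeff d p * ∏ j, (if w j < w s then a j else 0) ^ d j := by
    intro d hd
    have hdw : Finsupp.weight w d ≤ w s := (le_weightedTotalDegree w hd).trans hp
    by_cases hlow : ∀ j, d j ≠ 0 → w j < w s
    · rw [if_neg, zero_add]
      · congr 1
        refine Finset.prod_congr rfl fun j _ => ?_
        by_cases hj : d j = 0
        · simp [hj]
        · rw [if_pos (hlow j hj)]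
      · rintro rfl
        exact lt_irrefl _ (hlow s (by simp))
    · push Not at hlow
      obtain ⟨j, hj, hle⟩ := hlow
      have hsub := Finsupp.weight_sub_single_add (w := w) hj
      have hjs : j = s := hinj (by omega)
      subst hjs
      haveI := Finsupp.nonTorsionWeight_of (R := ℕ) w hw
      have hzero : d - Finsupp.single j 1 = 0 :=
        (Finsupp.weight_eq_zero_iff_eq_zero w).mp (by omega)
      have hd1 : d = Finsupp.single j 1 := by
        rw [← Finsupp.sub_add_single_one_cancel hj, hzero, zero_add]
      have hprod : ∏ i, (if w i < w j then a i else 0) ^ d i = 0 :=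
        Finset.prod_eq_zero (Finset.mem_univ j) (by simp [hj])
      rw [hprod, hd1, if_pos rfl, mul_zero, add_zero]
      congr 1
      rw [Finset.prod_eq_single j]
      · simp
      · intro i _ hij
        simp [Finsupp.single_eq_of_ne hij]
      · simp
  rw [eval_eq', eval_eq', Finset.sum_congr rfl key, Finset.sum_add_distrib,
    Finset.sum_ite_eq']
  split_ifs with h
  · rfl
  · rw [notMem_support_iff.mp h, zero_mul]

/-- A system whose `i`-th equation has a linear term in the variable `X (J i)` and weight at most
that of `X (J i)` can be solved with arbitrary values of the variables outside the range
of `J`. -/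
theorem exists_common_zero_extending [Fintype σ] [Field F] {ι : Type*} {w : σ → ℕ}
    (hw : ∀ j, w j ≠ 0) (hinj : Function.Injective w) {p : ι → MvPolynomial σ F} {J : ι → σ}
    (hJ : Function.Injective J) (hp : ∀ i, weightedTotalDegree w (p i) ≤ w (J i))
    (hc : ∀ i, MvPolynomial.coeff (Finsupp.single (J i) 1) (p i) ≠ 0) (b : σ → F) :
    ∃ a : σ → F, (∀ i, MvPolynomial.eval a (p i) = 0) ∧ ∀ j ∉ Set.range J, a j = b j := by
  let step : (x : σ) → ((y : σ) → w y < w x → F) → F := fun x g =>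
    if h : x ∈ Set.range J then
      -(MvPolynomial.coeff (Finsupp.single x 1) (p h.choose))⁻¹
        * MvPolynomial.eval (fun y => if hy : w y < w x then g y hy else 0) (p h.choose)
    else b x
  let wf : WellFounded fun y x : σ => w y < w x := InvImage.wf w Nat.lt_wfRel.wf
  have ha : ∀ x, wf.fix step x = step x fun y _ => wf.fix step y := fun x => wf.fix_eq step x
  refine ⟨wf.fix step, fun i => ?_, fun j hj => ?_⟩
  · have hi : J i ∈ Set.range J := ⟨i, rfl⟩
    have hchoose : hi.choose = i := hJ hi.choose_spec
    rw [eval_eq_linear_add_eval_lower_weight hw hinj (hp i), ha (J i)]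
    simp only [step, dif_pos hi, hchoose, dite_eq_ite]
    rw [← mul_assoc, mul_neg, mul_inv_cancel₀ (hc i), neg_one_mul, neg_add_cancel]
  · rw [ha j]
    exact dif_neg hj

end WeightedTriangular

/-- If the Jacobian at the origin has full row rank and its `i`-th row is supported on the
variables of weight `n i`, for an injective weight, then the system has a distinguished
variable for each equation, and these are distinct. -/
theorem exists_injective_of_rank_eq {ι σ K : Type*} [Fintype ι] [Fintype σ] [Field K]
    {w : σ → ℕ} (hinj : Function.Injective w) {n : ι → ℕ} (M : Matrix ι σ K)
    (hrank : M.rank = Fintype.card ι) (hM : ∀ i j, M i j ≠ 0 → w j = n i) :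
    ∃ J : ι → σ, Function.Injective J ∧ ∀ i, M i (J i) ≠ 0 := by
  have hli : LinearIndependent K M.row := by
    rw [linearIndependent_iff_card_eq_finrank_span, ← hrank, M.rank_eq_finrank_span_row]
    rfl
  have hex : ∀ i, ∃ j, M i j ≠ 0 := by
    intro i
    by_contra! h
    exact hli.ne_zero i (funext h)
  choose J hJ using hex
  refine ⟨J, fun i i' h => ?_, hJ⟩
  by_contra hne
  have hcol : ∀ i₀ j, j ≠ J i₀ → M i₀ j = 0 := by
    intro i₀ j hj
    by_contra h
    exact hj (hinj ((hM i₀ j h).trans (hM i₀ _ (hJ i₀)).symm))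
  have hsum : M i' (J i) • M.row i + (-M i (J i)) • M.row i' = 0 := by
    funext j
    by_cases hj : j = J i
    · subst hj
      simp [mul_comm]
    · simp [hcol i j hj, hcol i' j (h ▸ hj)]
  have hpair := hli.comp ![i, i'] (by
    intro x y hxy
    fin_cases x <;> fin_cases y <;> simp_all [Ne.symm hne])
  have hrows : M.row ∘ ![i, i'] = ![M.row i, M.row i'] := by
    ext x : 1
    fin_cases x <;> rfl
  rw [hrows] at hpair
  have := LinearIndependent.pair_iff.mp hpair _ _ hsum
  exact hJ i (neg_eq_zero.mp this.2)

theorem monicOfCoeffs_coeff {R : Type*} [CommRing R] {r : ℕ} (a : Fin r → R) (j : Fin r) :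
    (monicOfCoeffs r a).coeff j = a j := by
  simp [monicOfCoeffs, Polynomial.coeff_X_pow, j.isLt.ne, Fin.val_inj]

theorem monicOfCoeffs_injective {R : Type*} [CommRing R] (r : ℕ) :
    Function.Injective (monicOfCoeffs (K := R) r) := fun a b h => by
  ext j
  rw [← monicOfCoeffs_coeff a, h, monicOfCoeffs_coeff]

/-- A triangular system in `r` variables over a finite field, not involving the `k`-th variable,
with `m` equations, has at least `q ^ (r - m)` solutions. -/
theorem card_pow_le_ncard_zeros {F : Type*} [Field F] [Fintype F] {r m : ℕ} {k : Fin r}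
    {w : {j : Fin r // j ≠ k} → ℕ} (hw : ∀ j, w j ≠ 0) (hinj : Function.Injective w)
    {p : Fin m → MvPolynomial {j : Fin r // j ≠ k} F} {J : Fin m → {j : Fin r // j ≠ k}}
    (hJ : Function.Injective J) (hp : ∀ i, weightedTotalDegree w (p i) ≤ w (J i))
    (hc : ∀ i, MvPolynomial.coeff (Finsupp.single (J i) 1) (p i) ≠ 0) :
    Fintype.card F ^ (r - m) ≤
      {a : Fin r → F | ∀ i, MvPolynomial.eval (fun j : {j : Fin r // j ≠ k} => a j.1) (p i)
        = 0}.ncard := by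
  set S := {a : Fin r → F | ∀ i, MvPolynomial.eval (fun j : {j : Fin r // j ≠ k} => a j.1) (p i)
        = 0}
  let J' : Fin m → Fin r := fun i => (J i).1
  have hJ' : Function.Injective J' := Subtype.val_injective.comp hJ
  let restr : S → ({j : Fin r // j ∉ Set.range J'} → F) := fun a j => a.1 j.1
  have hsurj : Function.Surjective restr := by
    intro b
    let b' : Fin r → F := fun j => if h : j ∉ Set.range J' then b ⟨j, h⟩ else 0
    obtain ⟨a, ha, hab⟩ := exists_common_zero_extending hw hinj hJ hp hc fun j => b' j.1
    let a' : Fin r → F := fun j => if h : j ≠ k then a ⟨j, h⟩ else b' j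
    have ha' : (fun j : {j : Fin r // j ≠ k} => a' j.1) = a := funext fun j => dif_pos j.2
    refine ⟨⟨a', fun i => ?_⟩, funext fun j => ?_⟩
    · rw [ha', ha i]
    · have hb' : b' j.1 = b j := dif_pos j.2
      rw [← hb']
      change a' j.1 = _
      by_cases h : j.1 ≠ k
      · refine (dif_pos h).trans (hab ⟨j.1, h⟩ ?_)
        rintro ⟨i, hi⟩
        exact j.2 ⟨i, congrArg Subtype.val hi⟩
      · exact dif_neg h
  have hcard := Nat.card_le_card_of_surjective restr hsurj
  have hcompl : Fintype.card {j : Fin r // j ∉ Set.range J'} = r - m := by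
    rw [Fintype.card_subtype_compl, Fintype.card_fin]
    congr 1
    exact (Set.card_range_of_injective hJ').trans (Fintype.card_fin m)
  rwa [Nat.card_eq_fintype_card, Fintype.card_fun, hcompl] at hcard

/-- Theorem (`estimation A`): under hypotheses (H1)–(H6), if `q > 15 δ_G^{13/3}`, then
`|A| ≥ q^{r−m}(1 − 3 δ_G^{13/6} q^{−1/2})`, `|A|⁻¹ ≤ q^{m−r}(1 + 15 δ_G^{13/6} q^{−1/2})`
and `|A| ≥ q^{r−m}/2`. -/
theorem cardinality_of_family_estimate
    (Fq K : Type) [Field Fq] [Fintype Fq] [Field K] [Algebra Fq K] [IsAlgClosure Fq K]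
    (q : ℕ) (hq : Fintype.card Fq = q)
    (r m : ℕ) (hm : 1 ≤ m) (hmr : m < r) (k : Fin r)
    (G : Fin m → MvPolynomial {j : Fin r // j ≠ k} Fq)
    -- the variety `W ⊆ K^r` of common zeros of `G_1, …, G_m`
    (W : Set (Fin r → K))
    (hW : W = {a | ∀ i, MvPolynomial.eval (fun j : {j : Fin r // j ≠ k} => a j.1)
        (MvPolynomial.map (algebraMap Fq K) (G i)) = 0})
    -- the components of highest weight of `G_1, …, G_m` (for `wt(A_j) = r - j`)
    (Gwt : Fin m → MvPolynomial {j : Fin r // j ≠ k} Fq)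
    (hGwt : ∀ i, Gwt i = MvPolynomial.weightedHomogeneousComponent
        (fun j : {j : Fin r // j ≠ k} => r - (j.1 : ℕ))
        (MvPolynomial.weightedTotalDegree
          (fun j : {j : Fin r // j ≠ k} => r - (j.1 : ℕ)) (G i)) (G i))
    -- (H1): `G_1, …, G_m` form a regular sequence
    (hH1 : RingTheory.Sequence.IsRegular (MvPolynomial {j : Fin r // j ≠ k} Fq) (List.ofFn G))
    -- (H2): the Jacobian of `G_1, …, G_m` has full rank `m` at every point of `W`
    (hH2 : ∀ a ∈ W, Matrix.rank (Matrix.of fun (i : Fin m) (j : {j : Fin r // j ≠ k}) =>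
        MvPolynomial.eval (fun j' : {j : Fin r // j ≠ k} => a j'.1)
          (MvPolynomial.pderiv j (MvPolynomial.map (algebraMap Fq K) (G i)))) = m)
    -- (H3): the highest-weight components also satisfy (H1) and (H2)
    (hH3reg : RingTheory.Sequence.IsRegular (MvPolynomial {j : Fin r // j ≠ k} Fq)
        (List.ofFn Gwt))
    (hH3rank : ∀ a : Fin r → K,
        (∀ i, MvPolynomial.eval (fun j : {j : Fin r // j ≠ k} => a j.1)
          (MvPolynomial.map (algebraMap Fq K) (Gwt i)) = 0) →
        Matrix.rank (Matrix.of fun (i : Fin m) (j : {j : Fin r // j ≠ k}) =>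
          MvPolynomial.eval (fun j' : {j : Fin r // j ≠ k} => a j'.1)
            (MvPolynomial.pderiv j (MvPolynomial.map (algebraMap Fq K) (Gwt i)))) = m)
    -- (H4): the non-squarefree locus in `W` has dimension at most `r - m - 1`
    (hH4 : dimOf K r {a | a ∈ W ∧ ¬ Squarefree (monicOfCoeffs r a)} + 1
        ≤ ((r - m : ℕ) : WithBot ℕ∞))
    -- (H5): dimension at most `r - m - 2`
    (hH5 : dimOf K r
        ({a | a ∈ W ∧ ¬ Squarefree (monicOfCoeffs r a)
            ∧ a ⟨0, lt_of_le_of_lt (Nat.zero_le m) hmr⟩ = 0}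
          ∪ {a | a ∈ W ∧ 2 ≤ (EuclideanDomain.gcd (monicOfCoeffs r a)
              (Polynomial.derivative (monicOfCoeffs r a))).degree}) + 2
        ≤ ((r - m : ℕ) : WithBot ℕ∞))
    -- (H6): the non-squarefree locus of the variety at infinity has dimension `≤ r - m - 1`
    (hH6 : dimOf K r {a | (∀ i, MvPolynomial.eval (fun j : {j : Fin r // j ≠ k} => a j.1)
          (MvPolynomial.map (algebraMap Fq K) (Gwt i)) = 0)
          ∧ ¬ Squarefree (monicOfCoeffs r a)} + 1 ≤ ((r - m : ℕ) : WithBot ℕ∞))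
    -- the family `A` of monic polynomials of degree `r` over `F_q`
    (A : Set (Polynomial Fq))
    (hA : A = {f | ∃ a : Fin r → Fq, (∀ i, MvPolynomial.eval
        (fun j : {j : Fin r // j ≠ k} => a j.1) (G i) = 0) ∧ f = monicOfCoeffs r a})
    -- `δ_G`: the product of the total degrees of the `G_i`
    (dG : ℝ) (hdG : dG = ∏ i : Fin m, (MvPolynomial.totalDegree (G i) : ℝ))
    -- `q > 15 δ_G^{13/3}` (as real numbers)
    (hq15 : 15 * dG ^ ((13 : ℝ) / 3) < (q : ℝ)) :
    (q : ℝ) ^ (r - m) * (1 - 3 * dG ^ ((13 : ℝ) / 6) / Real.sqrt q) ≤ (A.ncard : ℝ)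
    ∧ ((A.ncard : ℝ))⁻¹ ≤ (q : ℝ) ^ ((m : ℝ) - (r : ℝ))
        * (1 + 15 * dG ^ ((13 : ℝ) / 6) / Real.sqrt q)
    ∧ (q : ℝ) ^ (r - m) / 2 ≤ (A.ncard : ℝ) := by
  have hw : ∀ j : {j : Fin r // j ≠ k}, r - (j.1 : ℕ) ≠ 0 := fun j => by omega
  have hinj : Function.Injective fun j : {j : Fin r // j ≠ k} => r - (j.1 : ℕ) := by
    intro i j h
    ext
    have := i.1.isLt
    have := j.1.isLt
    simp only at h
    omega
  have hconst : ∀ i, constantCoeff (Gwt i) = 0 := by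
    intro i
    by_contra h
    rw [hGwt i] at h
    have hunit := isUnit_weightedHomogeneousComponent_of_constantCoeff_ne_zero hw h
    rw [← hGwt i] at hunit
    apply hH3reg.top_ne_smul
    rw [Ideal.eq_top_of_isUnit_mem (Ideal.ofList (List.ofFn Gwt)) (x := Gwt i)
      (Ideal.subset_span (by simp [List.mem_ofFn])) hunit]
    simp
  have hrank := hH3rank 0 fun i => by
    change MvPolynomial.eval (fun _ => 0) _ = 0
    rw [eval_zero', constantCoeff_map, hconst i, map_zero]
  have hentry : ∀ i (j : {j : Fin r // j ≠ k}),
      MvPolynomial.eval (fun j' : {j : Fin r // j ≠ k} => (0 : Fin r → K) j'.1)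
        (MvPolynomial.pderiv j (MvPolynomial.map (algebraMap Fq K) (Gwt i)))
      = algebraMap Fq K (MvPolynomial.coeff (Finsupp.single j 1) (Gwt i)) := by
    intro i j
    change MvPolynomial.eval (fun _ => 0) _ = _
    rw [eval_zero', constantCoeff_eq, MvPolynomial.coeff_pderiv]
    simp [MvPolynomial.coeff_map]
  have hcoeff : ∀ i (j : {j : Fin r // j ≠ k}),
      MvPolynomial.coeff (Finsupp.single j 1) (Gwt i) ≠ 0 →
      r - (j.1 : ℕ) = weightedTotalDegree (fun j : {j : Fin r // j ≠ k} => r - (j.1 : ℕ)) (G i)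
        ∧ MvPolynomial.coeff (Finsupp.single j 1) (G i) ≠ 0 := by
    intro i j h
    rw [hGwt i, coeff_weightedHomogeneousComponent] at h
    split_ifs at h with h'
    · exact ⟨by simpa [Finsupp.weight_single] using h', h⟩
    · exact absurd rfl h
  obtain ⟨J, hJ, hJne⟩ := exists_injective_of_rank_eq hinj _ (by rw [hrank, Fintype.card_fin])
    fun i j h => (hcoeff i j fun h0 => h (by rw [Matrix.of_apply, hentry, h0, map_zero])).1
  have hJc := fun i => hcoeff i (J i) fun h0 => hJne i (by
    rw [Matrix.of_apply, hentry, h0, map_zero])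
  have hcard := card_pow_le_ncard_zeros hw hinj hJ (fun i => (hJc i).1.ge) fun i => (hJc i).2
  have hAcard : q ^ (r - m) ≤ A.ncard := by
    have hAimage : A = monicOfCoeffs r '' {a : Fin r → Fq | ∀ i,
        MvPolynomial.eval (fun j : {j : Fin r // j ≠ k} => a j.1) (G i) = 0} := by
      rw [hA]
      ext f
      exact exists_congr fun a => and_congr_right fun _ => eq_comm
    rw [hAimage, Set.ncard_image_of_injective _ (monicOfCoeffs_injective r), ← hq]
    exact hcard
  have hA' : (q : ℝ) ^ (r - m) ≤ A.ncard := mod_cast hAcard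
  have hq0 : (0 : ℝ) < q := by
    rw [← hq]
    exact mod_cast Fintype.card_pos
  have hpow : (0 : ℝ) < (q : ℝ) ^ (r - m) := by positivity
  have hdG0 : 0 ≤ dG := by
    rw [hdG]
    positivity
  have herr : 0 ≤ dG ^ ((13 : ℝ) / 6) / Real.sqrt q := by positivity
  refine ⟨le_trans ?_ hA', ?_, by linarith⟩
  · refine mul_le_of_le_one_right hpow.le ?_
    rw [mul_div_assoc]
    linarith
  · have hexp : (q : ℝ) ^ ((m : ℝ) - (r : ℝ)) = ((q : ℝ) ^ (r - m))⁻¹ := by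
      rw [← Real.rpow_natCast, ← Real.rpow_neg hq0.le, Nat.cast_sub hmr.le, neg_sub]
    rw [hexp]
    refine (inv_anti₀ hpow hA').trans (le_mul_of_one_le_right (by positivity) ?_)
    rw [mul_div_assoc]
    linarith
end

section
/- Assume hypotheses (H1)–(H6), and let δ_G := ∏_{i=1}^m deg G_i (product of the total degrees). If q > 15·δ_G^{13/3} (as real numbers), then the proportion of squarefree polynomials in A satisfies |A^{sq}|/|A| ≥ 1 − 2·r²·δ_G/q, where A^{sq} denotes the set of squarefree elements of A. In particular, if moreover q > 4·r²·δ_G, then |A^{sq}|/|A| > 1/2. -/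
open MvPolynomial Polynomial
open scoped Classical

section TriangularSystems

variable {F : Type*} [Field F] {r m : ℕ}

/-- The solution of a triangular system `x (e i) = H i`, where `H i` only involves variables with
index larger than `e i`, as a family of polynomials in the variables outside the range of `e`. -/
noncomputable def triangularSolution (e : Fin m → Fin r) (H : Fin m → MvPolynomial (Fin r) F)
    (j : Fin r) : MvPolynomial {j : Fin r // j ∉ Set.range e} F :=
  if h : j ∈ Set.range e then
    MvPolynomial.aeval
      (fun j' => if _h : j < j' then triangularSolution e H j' else 0) (H h.choose)
  else MvPolynomial.X ⟨j, h⟩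
termination_by r - (j : ℕ)

theorem aeval_congr_of_vars {σ R S : Type*} [CommSemiring R] [CommSemiring S] [Algebra R S]
    {g₁ g₂ : σ → S} {p : MvPolynomial σ R} (h : ∀ i ∈ p.vars, g₁ i = g₂ i) :
    MvPolynomial.aeval g₁ p = MvPolynomial.aeval g₂ p :=
  MvPolynomial.eval₂Hom_congr' rfl (fun i hi _ => h i hi) rfl

theorem triangularSolution_of_notMem (e : Fin m → Fin r) (H : Fin m → MvPolynomial (Fin r) F)
    (j : {j : Fin r // j ∉ Set.range e}) :
    triangularSolution e H j.1 = MvPolynomial.X j := by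
  rw [triangularSolution, dif_neg j.2]

theorem triangularSolution_apply {e : Fin m → Fin r} (he : Function.Injective e)
    {H : Fin m → MvPolynomial (Fin r) F} (hH : ∀ i, ∀ j ∈ (H i).vars, e i < j) (i : Fin m) :
    triangularSolution e H (e i) = MvPolynomial.aeval (triangularSolution e H) (H i) := by
  have h : e i ∈ Set.range e := ⟨i, rfl⟩
  have hi : h.choose = i := he h.choose_spec
  rw [triangularSolution, dif_pos h, hi]
  exact aeval_congr_of_vars fun j hj => dif_pos (hH i j hj)

theorem totalDegree_aeval_le {σ τ : Type*} (P : σ → MvPolynomial τ F) (p : MvPolynomial σ F)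
    (B : ℕ) (hB : ∀ j ∈ p.vars, (P j).totalDegree ≤ B) :
    (MvPolynomial.aeval P p).totalDegree ≤ p.totalDegree * B := by
  rw [MvPolynomial.aeval_def, MvPolynomial.eval₂_eq]
  refine MvPolynomial.totalDegree_finsetSum_le fun d hd => ?_
  refine (MvPolynomial.totalDegree_mul _ _).trans ?_
  rw [MvPolynomial.algebraMap_eq, MvPolynomial.totalDegree_C, zero_add]
  refine (MvPolynomial.totalDegree_finsetProd _ _).trans ?_
  calc ∑ j ∈ d.support, (P j ^ d j).totalDegree
      ≤ ∑ j ∈ d.support, d j * B := Finset.sum_le_sum fun j hj =>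
        (MvPolynomial.totalDegree_pow _ _).trans (Nat.mul_le_mul_left _
          (hB j ((MvPolynomial.mem_vars_iff_mem_support j).2 ⟨d, hd, hj⟩)))
    _ = (d.sum fun _ n => n) * B := by rw [Finsupp.sum, Finset.sum_mul]
    _ ≤ p.totalDegree * B := Nat.mul_le_mul_right _ (MvPolynomial.le_totalDegree hd)

theorem totalDegree_triangularSolution_le {e : Fin m → Fin r} (he : Function.Injective e)
    {H : Fin m → MvPolynomial (Fin r) F} (hH : ∀ i, ∀ j ∈ (H i).vars, e i < j)
    {d : Fin m → ℕ} (hd : ∀ i, 1 ≤ d i) (hHd : ∀ i, (H i).totalDegree ≤ d i) (j : Fin r) :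
    (triangularSolution e H j).totalDegree ≤ ∏ i with j ≤ e i, d i := by
  induction j using WellFoundedGT.induction with
  | ind j ih =>
    by_cases hj : j ∈ Set.range e
    · obtain ⟨i, rfl⟩ := hj
      rw [triangularSolution_apply he hH]
      refine (totalDegree_aeval_le _ _ (∏ l with e i < e l, d l) fun j' hj' => ?_).trans ?_
      · refine (ih j' (hH i j' hj')).trans ?_
        refine Finset.prod_le_prod_of_subset_of_one_le' ?_ fun l _ _ => hd l
        intro l hl
        simp only [Finset.mem_filter, Finset.mem_univ, true_and] at hl ⊢
        exact (hH i j' hj').trans_le hl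
      · have hset : (Finset.univ.filter fun l => e i ≤ e l)
            = insert i (Finset.univ.filter fun l => e i < e l) := by
          ext l
          simp only [Finset.mem_filter, Finset.mem_univ, true_and, Finset.mem_insert,
            le_iff_eq_or_lt, he.eq_iff, eq_comm]
        rw [hset, Finset.prod_insert (by simp)]
        exact Nat.mul_le_mul_right _ (hHd i)
    · rw [triangularSolution_of_notMem e H ⟨j, hj⟩, MvPolynomial.totalDegree_X]
      exact Finset.one_le_prod' fun l _ => hd l

theorem triangularSolution_unique {L : Type*} [Field L] [Algebra F L]
    {e : Fin m → Fin r} (he : Function.Injective e)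
    {H : Fin m → MvPolynomial (Fin r) F} (hH : ∀ i, ∀ j ∈ (H i).vars, e i < j) (a : Fin r → L) :
    (∀ i, a (e i) = MvPolynomial.aeval a (H i)) ↔
      a = fun j => MvPolynomial.aeval (fun l : {j : Fin r // j ∉ Set.range e} => a l.1)
        (triangularSolution e H j) := by
  constructor
  · intro ha
    funext j
    induction j using WellFoundedGT.induction with
    | ind j ih =>
      by_cases hj : j ∈ Set.range e
      · obtain ⟨i, rfl⟩ := hj
        rw [triangularSolution_apply he hH, ha i, MvPolynomial.comp_aeval_apply]
        exact aeval_congr_of_vars fun j' hj' => ih j' (hH i j' hj')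
      · rw [triangularSolution_of_notMem e H ⟨j, hj⟩, MvPolynomial.aeval_X]
  · intro ha i
    conv_lhs => rw [ha]
    simp only
    rw [triangularSolution_apply he hH, MvPolynomial.comp_aeval_apply, ← ha]

end TriangularSystems

section Resultant

theorem monic_and_natDegree_monicOfCoeffs {L : Type*} [Field L] (r : ℕ) (a : Fin r → L) :
    (monicOfCoeffs r a).Monic ∧ (monicOfCoeffs r a).natDegree = r := by
  have h : (∑ j : Fin r, Polynomial.C (a j) * Polynomial.X ^ (j : ℕ)).degree < (r : WithBot ℕ) := by
    refine (Polynomial.degree_sum_le _ _).trans_lt ?_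
    refine (Finset.sup_lt_iff (WithBot.bot_lt_coe r)).2 fun j _ => ?_
    exact (Polynomial.degree_C_mul_X_pow_le _ _).trans_lt (Nat.cast_lt.2 j.2)
  have hm := Polynomial.monic_X_pow_add h
  refine ⟨hm, ?_⟩
  rw [monicOfCoeffs, add_comm]
  refine Polynomial.natDegree_eq_of_degree_eq_some ?_
  rw [Polynomial.degree_add_eq_right_of_degree_lt (by simpa using h), Polynomial.degree_X_pow]

theorem coeff_monicOfCoeffs {L : Type*} [CommRing L] (r : ℕ) (a : Fin r → L) (n : ℕ) :
    (monicOfCoeffs r a).coeff n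
      = (if n = r then 1 else 0) + if h : n < r then a ⟨n, h⟩ else 0 := by
  rw [monicOfCoeffs, Polynomial.coeff_add, Polynomial.coeff_X_pow, Polynomial.finsetSum_coeff]
  congr 1
  simp only [Polynomial.coeff_C_mul, Polynomial.coeff_X_pow, mul_ite, mul_one, mul_zero]
  split_ifs with h
  · rw [Finset.sum_eq_single (⟨n, h⟩ : Fin r)]
    · simp
    · intro b _ hb
      rw [if_neg]
      rintro rfl
      exact hb rfl
    · simp
  · refine Finset.sum_eq_zero fun j _ => if_neg ?_
    rintro rfl
    exact h j.2

theorem monicOfCoeffs_injective_s3 {L : Type*} [CommRing L] (r : ℕ) :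
    Function.Injective (monicOfCoeffs r : (Fin r → L) → Polynomial L) := by
  intro a b hab
  funext j
  have h := congrArg (fun p => Polynomial.coeff p (j : ℕ)) hab
  simpa [coeff_monicOfCoeffs, j.2] using h

theorem map_monicOfCoeffs {R S : Type*} [CommRing R] [CommRing S] (φ : R →+* S) (r : ℕ)
    (a : Fin r → R) : (monicOfCoeffs r a).map φ = monicOfCoeffs r fun j => φ (a j) := by
  simp [monicOfCoeffs, Polynomial.map_sum]

theorem resultant_derivative_ne_zero_iff {L : Type*} [Field L] [PerfectField L] (r : ℕ)
    (a : Fin r → L) :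
    (monicOfCoeffs r a).resultant (Polynomial.derivative (monicOfCoeffs r a)) r (r - 1) ≠ 0 ↔
      Squarefree (monicOfCoeffs r a) := by
  obtain ⟨hm, hdeg⟩ := monic_and_natDegree_monicOfCoeffs r a
  set f := monicOfCoeffs r a
  have hle : (Polynomial.derivative f).natDegree ≤ r - 1 := by
    simpa [hdeg] using Polynomial.natDegree_derivative_le f
  obtain ⟨n, hn⟩ := Nat.exists_eq_add_of_le hle
  have hcoeff : f.coeff r = 1 := by rw [← hdeg]; exact hm.coeff_natDegree
  rw [hn, Polynomial.resultant_add_right_deg _ _ _ _ _ le_rfl, hcoeff, one_pow, one_mul,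
    ← PerfectField.separable_iff_squarefree, Polynomial.Separable,
    ← Polynomial.isUnit_resultant_iff_isCoprime hm, hdeg, isUnit_iff_ne_zero]

theorem totalDegree_det_le {τ R n : Type*} [CommRing R] [Fintype n] [DecidableEq n]
    (M : Matrix n n (MvPolynomial τ R)) (B : ℕ) (hM : ∀ i j, (M i j).totalDegree ≤ B) :
    M.det.totalDegree ≤ Fintype.card n * B := by
  rw [Matrix.det_apply]
  refine MvPolynomial.totalDegree_finsetSum_le fun s _ => ?_
  have hsmul : (Equiv.Perm.sign s • ∏ i, M (s i) i).totalDegree ≤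
      (∏ i, M (s i) i).totalDegree := by
    obtain h | h := Int.units_eq_one_or (Equiv.Perm.sign s) <;> simp [h]
  refine hsmul.trans ((MvPolynomial.totalDegree_finsetProd _ _).trans ?_)
  simpa using Finset.sum_le_sum fun i (_ : i ∈ Finset.univ) => hM (s i) i

theorem totalDegree_resultant_derivative_le {τ F : Type*} [Field F] (r : ℕ)
    (P : Fin r → MvPolynomial τ F) (B : ℕ) (hP : ∀ j, (P j).totalDegree ≤ B) :
    ((monicOfCoeffs r P).resultant
      (Polynomial.derivative (monicOfCoeffs r P)) r (r - 1)).totalDegree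
        ≤ (r + (r - 1)) * B := by
  have hc : ∀ n, ((monicOfCoeffs r P).coeff n).totalDegree ≤ B := by
    intro n
    rw [coeff_monicOfCoeffs]
    split_ifs with h₁ h₂ h₂
    · omega
    · simp
    · simpa using hP _
    · simp
  have hc' : ∀ n, ((Polynomial.derivative (monicOfCoeffs r P)).coeff n).totalDegree ≤ B := by
    intro n
    rw [Polynomial.coeff_derivative]
    refine (MvPolynomial.totalDegree_mul _ _).trans ?_
    have : ((n : MvPolynomial τ F) + 1).totalDegree = 0 := by
      rw [← Nat.cast_succ, ← map_natCast (MvPolynomial.C (σ := τ) (R := F)),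
        MvPolynomial.totalDegree_C]
    rw [this, add_zero]
    exact hc _
  have := totalDegree_det_le (Polynomial.sylvester (monicOfCoeffs r P)
    (Polynomial.derivative (monicOfCoeffs r P)) r (r - 1)) B ?_
  · simpa [Polynomial.resultant] using this
  · intro i j
    rw [Polynomial.sylvester, Matrix.of_apply]
    cases j using Fin.addCases with
    | left j => rw [Fin.addCases_left]; split_ifs <;> simp [hc']
    | right j => rw [Fin.addCases_right]; split_ifs <;> simp [hc]

end Resultant

section LinearTerms

variable {σ : Type*}

theorem constantCoeff_eq_zero_of_isRegular {F : Type*} [Field F] {m : ℕ}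
    {w : σ → ℕ} (hw : ∀ j, w j ≠ 0) {p : Fin m → MvPolynomial σ F} {n : Fin m → ℕ}
    (hp : ∀ i, (p i).IsWeightedHomogeneous w (n i))
    (hreg : RingTheory.Sequence.IsRegular (MvPolynomial σ F) (List.ofFn p)) (i : Fin m) :
    MvPolynomial.coeff 0 (p i) = 0 := by
  by_contra hc
  have : Finsupp.NonTorsionWeight ℕ w := Finsupp.nonTorsionWeight_of ℕ w hw
  have hn : n i = 0 := by simpa using (hp i hc).symm
  have hC : p i = MvPolynomial.C (MvPolynomial.coeff 0 (p i)) := by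
    ext d
    rw [MvPolynomial.coeff_C]
    split_ifs with hd
    · rw [hd]
    · by_contra hd'
      have h := hp i hd'
      rw [hn, Finsupp.weight_eq_zero_iff_eq_zero] at h
      exact hd h.symm
  apply hreg.top_ne_smul
  have hunit : IsUnit (p i) := by
    rw [hC]
    exact (isUnit_iff_ne_zero.2 hc).map MvPolynomial.C
  have hmem : p i ∈ Ideal.ofList (List.ofFn p) :=
    Ideal.subset_span (by simp [List.mem_ofFn])
  rw [Ideal.eq_top_of_isUnit_mem _ hmem hunit, Submodule.top_smul]

theorem exists_injective_coeff_single_ne_zero {F K : Type*} [Field F] [Field K] [Algebra F K]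
    [Fintype σ] {m : ℕ} {w : σ → ℕ} (hwi : Function.Injective w)
    {p : Fin m → MvPolynomial σ F} {n : Fin m → ℕ}
    (hp : ∀ i, (p i).IsWeightedHomogeneous w (n i))
    (hrank : Matrix.rank (Matrix.of fun (i : Fin m) (j : σ) =>
      MvPolynomial.eval (fun _ => (0 : K))
        (MvPolynomial.pderiv j (MvPolynomial.map (algebraMap F K) (p i)))) = m) :
    ∃ e : Fin m → σ, Function.Injective e ∧
      ∀ i, MvPolynomial.coeff (Finsupp.single (e i) 1) (p i) ≠ 0 ∧ n i = w (e i) := by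
  set M : Matrix (Fin m) σ K := Matrix.of fun (i : Fin m) (j : σ) =>
    MvPolynomial.eval (fun _ => (0 : K))
      (MvPolynomial.pderiv j (MvPolynomial.map (algebraMap F K) (p i))) with hMdef
  have hM : ∀ i j, M i j = algebraMap F K (MvPolynomial.coeff (Finsupp.single j 1) (p i)) := by
    intro i j
    have h0 : ∀ t : MvPolynomial σ K, MvPolynomial.eval (fun _ => (0 : K)) t
        = MvPolynomial.coeff 0 t := fun t => by
      rw [← MvPolynomial.constantCoeff_eq, ← MvPolynomial.eval_zero]; rfl
    rw [hMdef, Matrix.of_apply, h0, MvPolynomial.coeff_pderiv, MvPolynomial.coeff_map]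
    simp
  have hli : LinearIndependent K M.row := by
    rw [linearIndependent_iff_card_eq_finrank_span, Set.finrank, ← M.rank_eq_finrank_span_row,
      hrank, Fintype.card_fin]
  have hne : ∀ i, ∃ j, M i j ≠ 0 := by
    intro i
    by_contra! h
    exact hli.ne_zero i (funext h)
  choose e he using hne
  have hcoeff : ∀ i j, M i j ≠ 0 → n i = w j := by
    intro i j h
    rw [hM, Ne, map_eq_zero] at h
    simpa [Finsupp.weight_single] using (hp i h).symm
  refine ⟨e, fun i i' hii => ?_, fun i => ⟨?_, hcoeff i _ (he i)⟩⟩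
  · by_contra hne
    have hrow : ∀ l, M l = Pi.single (e l) (M l (e l)) := by
      intro l
      funext j
      by_cases hj : j = e l
      · rw [hj, Pi.single_eq_same]
      · rw [Pi.single_eq_of_ne hj]
        by_contra h
        exact hj (hwi ((hcoeff l j h).symm.trans (hcoeff l _ (he l))))
    have hdep : M i' (e i') • M.row i + (-M i (e i)) • M.row i' = 0 := by
      change M i' (e i') • M i + (-M i (e i)) • M i' = 0
      rw [hrow i, hrow i', hii]
      funext j
      by_cases hj : j = e i'
      · simp [hj]; ring
      · simp [hj]
    have := (LinearIndepOn.pair_iff M.row hne).1 (hli.linearIndepOn _) _ _ hdep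
    exact he i' this.1
  · intro h
    exact he i (by rw [hM, h, map_zero])

theorem weight_lt_of_mem_support_of_ne_single {F : Type*} [Field F] {w : σ → ℕ}
    (hw : ∀ j, w j ≠ 0) {p : MvPolynomial σ F} {l : σ}
    (hl : MvPolynomial.weightedTotalDegree w p = w l) (hwi : Function.Injective w)
    {d : σ →₀ ℕ} (hd : d ∈ p.support) (hdl : d ≠ Finsupp.single l 1) {j : σ} (hj : j ∈ d.support) :
    w j < w l := by
  have : Finsupp.NonTorsionWeight ℕ w := Finsupp.nonTorsionWeight_of ℕ w hw
  have h₁ : Finsupp.weight w d ≤ w l := hl ▸ MvPolynomial.le_weightedTotalDegree w hd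
  have hj1 : Finsupp.single j 1 ≤ d := by
    rw [Finsupp.single_le_iff]
    exact Nat.one_le_iff_ne_zero.2 (Finsupp.mem_support_iff.1 hj)
  obtain ⟨c, rfl⟩ := le_iff_exists_add.1 hj1
  rw [map_add, Finsupp.weight_single, one_smul] at h₁
  rcases (show w j ≤ w l by omega).lt_or_eq with h | h
  · exact h
  · exfalso
    have hc : Finsupp.weight w c = 0 := by omega
    rw [Finsupp.weight_eq_zero_iff_eq_zero] at hc
    exact hdl (by rw [hc, add_zero, hwi h])

theorem exists_triangular_form {F : Type*} [Field F] {r m : ℕ} {k : Fin r}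
    {G : Fin m → MvPolynomial {j : Fin r // j ≠ k} F} {e : Fin m → {j : Fin r // j ≠ k}}
    (he : ∀ i, MvPolynomial.coeff (Finsupp.single (e i) 1) (G i) ≠ 0)
    (hG : ∀ i, MvPolynomial.weightedTotalDegree
      (fun j : {j : Fin r // j ≠ k} => r - (j.1 : ℕ)) (G i) = r - ((e i).1 : ℕ)) :
    ∃ H : Fin m → MvPolynomial (Fin r) F, (∀ i, ∀ j ∈ (H i).vars, (e i).1 < j) ∧
      (∀ i, 1 ≤ (G i).totalDegree) ∧ (∀ i, (H i).totalDegree ≤ (G i).totalDegree) ∧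
      ∀ (L : Type) [Field L] [Algebra F L] (a : Fin r → L),
        (∀ i, MvPolynomial.aeval (fun j : {j : Fin r // j ≠ k} => a j.1) (G i) = 0) ↔
          ∀ i, a (e i).1 = MvPolynomial.aeval a (H i) := by
  classical
  have hdeg : ∀ i, 1 ≤ (G i).totalDegree := fun i => by
    simpa using MvPolynomial.le_totalDegree (MvPolynomial.mem_support_iff.2 (he i))
  refine ⟨fun i => MvPolynomial.rename Subtype.val (MvPolynomial.X (e i) -
    MvPolynomial.C (MvPolynomial.coeff (Finsupp.single (e i) 1) (G i))⁻¹ * G i),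
    fun i j hj => ?_, hdeg, fun i => ?_, fun L _ _ a => ?_⟩
  · obtain ⟨j, hjp, rfl⟩ := MvPolynomial.mem_vars_rename _ _ hj
    obtain ⟨d, hd, hjd⟩ := (MvPolynomial.mem_vars_iff_mem_support _).1 hjp
    rw [MvPolynomial.mem_support_iff, MvPolynomial.coeff_sub, MvPolynomial.coeff_C_mul,
      MvPolynomial.coeff_X] at hd
    have hdl : d ≠ Finsupp.single (e i) 1 := by
      rintro rfl
      simp [he i] at hd
    rw [if_neg hdl.symm, zero_sub, neg_ne_zero] at hd
    have h := weight_lt_of_mem_support_of_ne_single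
      (w := fun j : {j : Fin r // j ≠ k} => r - (j.1 : ℕ))
      (fun j => by have := j.1.2; omega) (hG i)
      (fun j j' h => by
        have := j.1.2; have := j'.1.2; apply Subtype.ext; apply Fin.ext; simp only at h; omega)
      (MvPolynomial.mem_support_iff.2 (right_ne_zero_of_mul hd)) hdl hjd
    rw [Fin.lt_def]
    omega
  · refine (MvPolynomial.totalDegree_rename_le _ _).trans
      ((MvPolynomial.totalDegree_sub _ _).trans (max_le ?_ ?_))
    · simpa using hdeg i
    · exact (MvPolynomial.totalDegree_mul _ _).trans (by simp)
  · refine forall_congr' fun i => ?_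
    rw [MvPolynomial.aeval_rename, map_sub, map_mul, MvPolynomial.aeval_X, MvPolynomial.aeval_C,
      Function.comp_apply, eq_comm (a := a _), sub_eq_self, mul_eq_zero,
      or_iff_right (by simp [he i])]
    rfl

end LinearTerms

section Counting

theorem ncard_zeros_mul_card_le {τ F : Type*} [Fintype τ] [Field F] [Fintype F]
    {D : MvPolynomial τ F} (hD : D ≠ 0) :
    ({b : τ → F | MvPolynomial.eval b D = 0}.ncard : ℝ) * Fintype.card F
      ≤ D.totalDegree * (Fintype.card F : ℝ) ^ Fintype.card τ := by
  set ε := Fintype.equivFin τ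
  have hD' : MvPolynomial.rename ε D ≠ 0 :=
    (map_ne_zero_iff _ (MvPolynomial.rename_injective _ ε.injective)).2 hD
  have h := MvPolynomial.schwartz_zippel_totalDegree hD' (Finset.univ : Finset F)
  have hcard : {b : τ → F | MvPolynomial.eval b D = 0}.ncard =
      (Finset.filter (fun f => MvPolynomial.eval f (MvPolynomial.rename ε D) = 0)
        (Fintype.piFinset fun _ => (Finset.univ : Finset F))).card := by
    rw [← Set.ncard_coe_finset]
    refine Set.ncard_congr (fun b _ => b ∘ ε.symm) ?_ ?_ ?_
    · intro b hb
      simpa [MvPolynomial.eval_rename, Function.comp_assoc] using hb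
    · intro b b' _ _ hbb
      simpa [Function.comp_assoc] using congrArg (· ∘ ε) hbb
    · intro b hb
      refine ⟨b ∘ ε, ?_, by simp [Function.comp_assoc]⟩
      simpa [MvPolynomial.eval_rename] using hb
  rw [← hcard, div_le_div_iff₀ (by simp [pow_pos, Fintype.card_pos])
    (by simp [Fintype.card_pos]), Finset.card_univ] at h
  have h' : ({b : τ → F | MvPolynomial.eval b D = 0}.ncard : ℝ) * Fintype.card F
      ≤ (MvPolynomial.rename ε D).totalDegree * (Fintype.card F : ℝ) ^ Fintype.card τ := by
    exact_mod_cast h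
  refine h'.trans (mul_le_mul_of_nonneg_right ?_ (by positivity))
  exact_mod_cast MvPolynomial.totalDegree_rename_le _ _

end Counting

theorem not_add_one_le_of_natCast_le {x : WithBot ℕ∞} {n : ℕ} (h : (n : WithBot ℕ∞) ≤ x) :
    ¬ x + 1 ≤ n := by
  intro h'
  have : n + 1 ≤ n := by exact_mod_cast (add_le_add_left h 1).trans h'
  omega

theorem card_le_dimOf_of_parametrization {K τ : Type*} [Field K] [Infinite K] [Fintype τ] {r : ℕ}
    (P : Fin r → MvPolynomial τ K) (v : τ → Fin r) (hv : ∀ j, P (v j) = MvPolynomial.X j)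
    {Z : Set (Fin r → K)} (hZ : ∀ b : τ → K, (fun j => MvPolynomial.eval b (P j)) ∈ Z) :
    ((Fintype.card τ : ℕ) : WithBot ℕ∞) ≤ dimOf K r Z := by
  have hker : ∀ p ∈ vanishingIdealOf K r Z, (MvPolynomial.aeval P).toRingHom p = 0 := by
    intro p hp
    refine MvPolynomial.funext fun b => ?_
    have h := hp _ (hZ b)
    rw [map_zero, AlgHom.toRingHom_eq_coe, RingHom.coe_coe, ← MvPolynomial.coe_aeval_eq_eval,
      RingHom.coe_coe, MvPolynomial.comp_aeval_apply]
    simpa [MvPolynomial.coe_aeval_eq_eval] using h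
  have hsurj : Function.Surjective (MvPolynomial.aeval (R := K) P).toRingHom := by
    rw [AlgHom.toRingHom_eq_coe, RingHom.coe_coe]
    intro p
    refine ⟨MvPolynomial.rename v p, ?_⟩
    rw [MvPolynomial.aeval_rename, show P ∘ v = MvPolynomial.X from funext hv,
      MvPolynomial.aeval_X_left_apply]
  have h := ringKrullDim_le_of_surjective (Ideal.Quotient.lift _ _ hker)
    (Ideal.Quotient.lift_surjective_of_surjective _ hker hsurj)
  rw [MvPolynomial.ringKrullDim_of_isNoetherianRing, ringKrullDim_eq_zero_of_field, zero_add,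
    Nat.card_eq_fintype_card] at h
  exact h

/-- Under hypotheses (H1)–(H6), if `q > 15 δ_G^{13/3}`, then the proportion of squarefree
polynomials in `A` is at least `1 − 2 r² δ_G / q`; if moreover `q > 4 r² δ_G`, it
exceeds `1/2`. -/
theorem proportion_of_squarefree_in_family
    (Fq K : Type) [Field Fq] [Fintype Fq] [Field K] [Algebra Fq K] [IsAlgClosure Fq K]
    (q : ℕ) (hq : Fintype.card Fq = q)
    (r m : ℕ) (hm : 1 ≤ m) (hmr : m < r) (k : Fin r)
    (G : Fin m → MvPolynomial {j : Fin r // j ≠ k} Fq)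
    -- the variety `W ⊆ K^r` of common zeros of `G_1, …, G_m`
    (W : Set (Fin r → K))
    (hW : W = {a | ∀ i, MvPolynomial.eval (fun j : {j : Fin r // j ≠ k} => a j.1)
        (MvPolynomial.map (algebraMap Fq K) (G i)) = 0})
    -- the components of highest weight of `G_1, …, G_m` (for `wt(A_j) = r - j`)
    (Gwt : Fin m → MvPolynomial {j : Fin r // j ≠ k} Fq)
    (hGwt : ∀ i, Gwt i = MvPolynomial.weightedHomogeneousComponent
        (fun j : {j : Fin r // j ≠ k} => r - (j.1 : ℕ))
        (MvPolynomial.weightedTotalDegree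
          (fun j : {j : Fin r // j ≠ k} => r - (j.1 : ℕ)) (G i)) (G i))
    -- (H1): `G_1, …, G_m` form a regular sequence
    (hH1 : RingTheory.Sequence.IsRegular (MvPolynomial {j : Fin r // j ≠ k} Fq) (List.ofFn G))
    -- (H2): the Jacobian of `G_1, …, G_m` has full rank `m` at every point of `W`
    (hH2 : ∀ a ∈ W, Matrix.rank (Matrix.of fun (i : Fin m) (j : {j : Fin r // j ≠ k}) =>
        MvPolynomial.eval (fun j' : {j : Fin r // j ≠ k} => a j'.1)
          (MvPolynomial.pderiv j (MvPolynomial.map (algebraMap Fq K) (G i)))) = m)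
    -- (H3): the highest-weight components also satisfy (H1) and (H2)
    (hH3reg : RingTheory.Sequence.IsRegular (MvPolynomial {j : Fin r // j ≠ k} Fq)
        (List.ofFn Gwt))
    (hH3rank : ∀ a : Fin r → K,
        (∀ i, MvPolynomial.eval (fun j : {j : Fin r // j ≠ k} => a j.1)
          (MvPolynomial.map (algebraMap Fq K) (Gwt i)) = 0) →
        Matrix.rank (Matrix.of fun (i : Fin m) (j : {j : Fin r // j ≠ k}) =>
          MvPolynomial.eval (fun j' : {j : Fin r // j ≠ k} => a j'.1)
            (MvPolynomial.pderiv j (MvPolynomial.map (algebraMap Fq K) (Gwt i)))) = m)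
    -- (H4): the non-squarefree locus in `W` has dimension at most `r - m - 1`
    (hH4 : dimOf K r {a | a ∈ W ∧ ¬ Squarefree (monicOfCoeffs r a)} + 1
        ≤ ((r - m : ℕ) : WithBot ℕ∞))
    -- (H5): dimension at most `r - m - 2`
    (hH5 : dimOf K r
        ({a | a ∈ W ∧ ¬ Squarefree (monicOfCoeffs r a)
            ∧ a ⟨0, lt_of_le_of_lt (Nat.zero_le m) hmr⟩ = 0}
          ∪ {a | a ∈ W ∧ 2 ≤ (EuclideanDomain.gcd (monicOfCoeffs r a)
              (Polynomial.derivative (monicOfCoeffs r a))).degree}) + 2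
        ≤ ((r - m : ℕ) : WithBot ℕ∞))
    -- (H6): the non-squarefree locus of the variety at infinity has dimension `≤ r - m - 1`
    (hH6 : dimOf K r {a | (∀ i, MvPolynomial.eval (fun j : {j : Fin r // j ≠ k} => a j.1)
          (MvPolynomial.map (algebraMap Fq K) (Gwt i)) = 0)
          ∧ ¬ Squarefree (monicOfCoeffs r a)} + 1 ≤ ((r - m : ℕ) : WithBot ℕ∞))
    -- the family `A` of monic polynomials of degree `r` over `F_q`
    (A : Set (Polynomial Fq))
    (hA : A = {f | ∃ a : Fin r → Fq, (∀ i, MvPolynomial.eval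
        (fun j : {j : Fin r // j ≠ k} => a j.1) (G i) = 0) ∧ f = monicOfCoeffs r a})
    -- `δ_G`: the product of the total degrees of the `G_i`
    (dG : ℝ) (hdG : dG = ∏ i : Fin m, (MvPolynomial.totalDegree (G i) : ℝ))
    -- `q > 15 δ_G^{13/3}` (as real numbers)
    (hq15 : 15 * dG ^ ((13 : ℝ) / 3) < (q : ℝ)) :
    1 - 2 * (r : ℝ) ^ 2 * dG / q
      ≤ ({f | f ∈ A ∧ Squarefree f}.ncard : ℝ) / (A.ncard : ℝ)
    ∧ (4 * (r : ℝ) ^ 2 * dG < (q : ℝ) →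
        (1 : ℝ) / 2 < ({f | f ∈ A ∧ Squarefree f}.ncard : ℝ) / (A.ncard : ℝ)) := by
  let w : {j : Fin r // j ≠ k} → ℕ := fun j => r - (j.1 : ℕ)
  have hw : ∀ j, w j ≠ 0 := fun j => by
    have := j.1.2
    simp only [w]
    omega
  have hwi : Function.Injective w := fun j j' h => by
    have := j.1.2
    have := j'.1.2
    simp only [w] at h
    exact Subtype.ext (Fin.ext (by omega))
  have hhom : ∀ i, (Gwt i).IsWeightedHomogeneous w (MvPolynomial.weightedTotalDegree w (G i)) :=
    fun i => by
      rw [hGwt i]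
      exact MvPolynomial.weightedHomogeneousComponent_isWeightedHomogeneous _ _
  have hzero : ∀ i, MvPolynomial.eval (fun _ : {j : Fin r // j ≠ k} => (0 : K))
      (MvPolynomial.map (algebraMap Fq K) (Gwt i)) = 0 := fun i => by
    rw [MvPolynomial.eval_map, show (fun _ : {j : Fin r // j ≠ k} => (0 : K)) = 0 from rfl,
      MvPolynomial.eval₂_zero_apply, MvPolynomial.constantCoeff_eq,
      constantCoeff_eq_zero_of_isRegular hw hhom hH3reg i, map_zero]
  obtain ⟨e, he, hec⟩ := exists_injective_coeff_single_ne_zero hwi hhom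
    (hH3rank (fun _ => 0) hzero)
  have hec' : ∀ i, MvPolynomial.coeff (Finsupp.single (e i) 1) (G i) ≠ 0 := fun i h => by
    apply (hec i).1
    rw [hGwt i, MvPolynomial.coeff_weightedHomogeneousComponent, h, ite_self]
  obtain ⟨H, hH, hdeg, hHdeg, hsol⟩ := exists_triangular_form hec' fun i => (hec i).2
  let E : Fin m → Fin r := fun i => (e i).1
  have hE : Function.Injective E := Subtype.val_injective.comp he
  obtain ⟨P, hP⟩ : ∃ P, P = triangularSolution E H := ⟨_, rfl⟩
  have hfree : ∀ j : {j : Fin r // j ∉ Set.range E}, P j.1 = MvPolynomial.X j :=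
    hP ▸ triangularSolution_of_notMem E H
  have hpar : ∀ (L : Type) [Field L] [Algebra Fq L] (a : Fin r → L),
      (∀ i, MvPolynomial.aeval (fun j : {j : Fin r // j ≠ k} => a j.1) (G i) = 0) ↔
        ∃ b : {j : Fin r // j ∉ Set.range E} → L, a = fun j => MvPolynomial.aeval b (P j) := by
    intro L _ _ a
    rw [hsol L a, triangularSolution_unique hE hH a, ← hP]
    refine ⟨fun h => ⟨_, h⟩, ?_⟩
    rintro ⟨b, rfl⟩
    simp only [hfree, MvPolynomial.aeval_X]
  have hmem : ∀ a, a ∈ W ↔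
      ∀ i, MvPolynomial.aeval (fun j : {j : Fin r // j ≠ k} => a j.1) (G i) = 0 := fun a => by
    simp only [hW, Set.mem_ofPred_eq, MvPolynomial.eval_map, MvPolynomial.aeval_def]
  have hcard : Fintype.card {j : Fin r // j ∉ Set.range E} = r - m := by
    rw [Fintype.card_subtype_compl, Fintype.card_fin]
    congr 1
    have h := Set.card_range_of_injective hE
    rw [Fintype.card_fin] at h
    convert h
  obtain ⟨D, hD⟩ : ∃ D, D = (monicOfCoeffs r P).resultant
      (Polynomial.derivative (monicOfCoeffs r P)) r (r - 1) := ⟨_, rfl⟩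
  have hsq : ∀ (L : Type) [Field L] [PerfectField L] [Algebra Fq L]
      (b : {j : Fin r // j ∉ Set.range E} → L), MvPolynomial.aeval b D ≠ 0 ↔
        Squarefree (monicOfCoeffs r fun j => MvPolynomial.aeval b (P j)) := by
    intro L _ _ _ b
    have h := map_monicOfCoeffs (MvPolynomial.aeval (R := Fq) b).toRingHom r P
    rw [← RingHom.coe_coe, ← AlgHom.toRingHom_eq_coe, hD, ← Polynomial.resultant_map_map,
      ← Polynomial.derivative_map, h]
    exact resultant_derivative_ne_zero_iff r _
  have : IsAlgClosed K := IsAlgClosure.isAlgClosed Fq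
  have hD0 : D ≠ 0 := by
    intro h0
    have hdim := card_le_dimOf_of_parametrization
      (fun j => MvPolynomial.map (algebraMap Fq K) (P j))
      (fun j : {j : Fin r // j ∉ Set.range E} => j.1) (fun j => by rw [hfree, MvPolynomial.map_X])
      (Z := {a | a ∈ W ∧ ¬ Squarefree (monicOfCoeffs r a)}) (fun b => by
        simp only [MvPolynomial.eval_map, ← MvPolynomial.aeval_def]
        rw [Set.mem_ofPred_eq]
        refine ⟨?_, fun hs => (hsq K b).2 hs (by rw [h0, map_zero])⟩
        exact (hmem _).2 ((hpar K fun j => MvPolynomial.aeval b (P j)).2 ⟨b, rfl⟩))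
    rw [hcard] at hdim
    exact not_add_one_le_of_natCast_le hdim hH4
  have hDdeg : (D.totalDegree : ℝ) ≤ 2 * (r : ℝ) ^ 2 * dG := by
    rw [hP] at hD
    have h := totalDegree_resultant_derivative_le r (triangularSolution E H)
      (∏ i, (G i).totalDegree) fun j =>
      (totalDegree_triangularSolution_le hE hH hdeg hHdeg j).trans
        (Finset.prod_le_prod_of_subset_of_one_le' (Finset.filter_subset _ _) fun i _ _ => hdeg i)
    have h' : D.totalDegree ≤ 2 * r ^ 2 * ∏ i, (G i).totalDegree :=
      (hD ▸ h).trans (Nat.mul_le_mul_right _ (by have := Nat.le_self_pow two_ne_zero r; omega))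
    rw [hdG]
    exact_mod_cast h'
  let φ : ({j : Fin r // j ∉ Set.range E} → Fq) → Polynomial Fq :=
    fun b => monicOfCoeffs r fun j => MvPolynomial.eval b (P j)
  have hφ : Function.Injective φ := fun b b' h => by
    funext j
    have h' := congrFun (monicOfCoeffs_injective_s3 r h) j.1
    simpa [hfree] using h'
  have hAφ : A = φ '' Set.univ := by
    rw [hA]
    ext f
    simp only [Set.mem_ofPred_eq, Set.image_univ, Set.mem_range]
    constructor
    · rintro ⟨a, ha, rfl⟩
      obtain ⟨b, rfl⟩ := (hpar Fq a).1 (by simpa [MvPolynomial.coe_aeval_eq_eval] using ha)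
      exact ⟨b, by simp [φ]⟩
    · rintro ⟨b, rfl⟩
      refine ⟨_, ?_, rfl⟩
      simpa [MvPolynomial.coe_aeval_eq_eval] using (hpar Fq _).2 ⟨b, rfl⟩
  have hSφ : {f | f ∈ A ∧ Squarefree f} = φ '' {b | MvPolynomial.eval b D = 0}ᶜ := by
    have h : ∀ b, MvPolynomial.eval b D ≠ 0 ↔ Squarefree (φ b) := fun b => by
      simpa [MvPolynomial.coe_aeval_eq_eval] using hsq Fq b
    rw [hAφ]
    ext f
    constructor
    · rintro ⟨⟨b, -, rfl⟩, hs⟩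
      exact ⟨b, (h b).2 hs, rfl⟩
    · rintro ⟨b, hb, rfl⟩
      exact ⟨⟨b, trivial, rfl⟩, (h b).1 hb⟩
  have hq0 : (0 : ℝ) < q := by
    rw [← hq]
    exact_mod_cast Fintype.card_pos
  set N := Fintype.card {j : Fin r // j ∉ Set.range E}
  have hAcard : (A.ncard : ℝ) = (q : ℝ) ^ N := by
    rw [hAφ, Set.ncard_image_of_injective _ hφ, Set.ncard_univ, Nat.card_eq_fintype_card,
      Fintype.card_fun, hq]
    push_cast
    rfl
  set Z := {b : {j : Fin r // j ∉ Set.range E} → Fq | MvPolynomial.eval b D = 0}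
  have hScard : ({f | f ∈ A ∧ Squarefree f}.ncard : ℝ) = (q : ℝ) ^ N - Z.ncard := by
    rw [hSφ, Set.ncard_image_of_injective _ hφ, eq_sub_iff_add_eq, ← hAcard, hAφ,
      Set.ncard_image_of_injective _ hφ, Set.ncard_univ, ← Set.ncard_add_ncard_compl Z]
    push_cast
    ring
  have hZ : (Z.ncard : ℝ) * q ≤ D.totalDegree * (q : ℝ) ^ N := by
    rw [← hq]
    exact ncard_zeros_mul_card_le hD0
  have hqN : (0 : ℝ) < (q : ℝ) ^ N := pow_pos hq0 N
  have hmain : 1 - 2 * (r : ℝ) ^ 2 * dG / q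
      ≤ ({f | f ∈ A ∧ Squarefree f}.ncard : ℝ) / (A.ncard : ℝ) := by
    rw [hScard, hAcard, sub_div, div_self hqN.ne']
    refine sub_le_sub_left ?_ _
    rw [div_le_div_iff₀ hqN hq0]
    exact hZ.trans (mul_le_mul_of_nonneg_right hDdeg hqN.le)
  refine ⟨hmain, fun h4 => lt_of_lt_of_le ?_ hmain⟩
  have : 2 * (r : ℝ) ^ 2 * dG / q < 1 / 2 := by
    rw [div_lt_iff₀ hq0]
    linarith
  linarith
end

section
/- Assume hypothesis (H1). Then the polynomials R_1,…,R_m form a regular sequence of F_q[X_1,…,X_r], and the Krull dimension of K[X_1,…,X_r]/(R_1,…,R_m) equals r−m (that is, the affine variety V := {x ∈ K^r : R_1(x)=⋯=R_m(x)=0} is a set-theoretic complete intersection of dimension r−m). -/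
open MvPolynomial Polynomial
open scoped Classical

universe u

namespace Polynomial

theorem freeMonic_map_aeval_coeff {R S : Type*} [CommRing R] [CommRing S] [Algebra R S] {n : ℕ}
    {p : S[X]} (hp : p.Monic) (hn : p.natDegree = n) :
    (freeMonic R n).map
      (MvPolynomial.aeval (R := R) fun j : Fin n => p.coeff j).toRingHom = p :=
  congrArg Subtype.val
    ((MvPolynomial.mapEquivMonic R S n).apply_symm_apply (MonicDegreeEq.mk p hp hn))

theorem natDegree_X_sub_C_mul_freeMonic {R : Type*} [CommRing R] [Nontrivial R] (n : ℕ)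
    (a : MvPolynomial (Fin n) R) :
    ((X - C a) * freeMonic R n).natDegree = n + 1 := by
  rw [(monic_X_sub_C a).natDegree_mul (monic_freeMonic R n), natDegree_X_sub_C,
    natDegree_freeMonic, add_comm]

end Polynomial

namespace MvPolynomial

open Polynomial (freeMonic)

/-- The map `R[A_0, …, A_n] → R[X][B_0, …, B_{n-1}]` which corresponds to the factorization of the
free monic polynomial of degree `n + 1` as `T - X` times the free monic polynomial of degree `n`. -/
noncomputable def splitLinearFactor (R : Type*) [CommRing R] (n : ℕ) :
    MvPolynomial (Fin (n + 1)) R →ₐ[R] MvPolynomial (Fin n) (Polynomial R) :=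
  aeval fun j => ((Polynomial.X - Polynomial.C (C Polynomial.X)) *
    freeMonic (Polynomial R) n).coeff j

theorem freeMonic_map_splitLinearFactor (R : Type*) [CommRing R] [Nontrivial R] (n : ℕ) :
    (freeMonic R (n + 1)).map (splitLinearFactor R n).toRingHom =
      (Polynomial.X - Polynomial.C (C Polynomial.X)) * freeMonic (Polynomial R) n :=
  Polynomial.freeMonic_map_aeval_coeff
    ((Polynomial.monic_X_sub_C _).mul (Polynomial.monic_freeMonic _ n))
    (Polynomial.natDegree_X_sub_C_mul_freeMonic n _)

theorem freeMonic_coeff_fin (R : Type*) [CommRing R] (n : ℕ) (j : Fin n) :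
    (freeMonic R n).coeff j = X j := by
  simp [Polynomial.coeff_freeMonic]

/-- Adjoining to `R[A_0, …, A_n]` a root of the free monic polynomial gives a polynomial ring. -/
theorem splitLinearFactor_faithfullyFlat (R : Type*) [CommRing R] [Nontrivial R] (n : ℕ) :
    (splitLinearFactor R n).toRingHom.FaithfullyFlat := by
  set f := freeMonic R (n + 1) with hf
  have hfm : f.Monic := Polynomial.monic_freeMonic R (n + 1)
  have hfd : f.natDegree = n + 1 := Polynomial.natDegree_freeMonic R (n + 1)
  set q := f.map (AdjoinRoot.of f) /ₘ (Polynomial.X - Polynomial.C (AdjoinRoot.root f)) with hq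
  have hXq : (Polynomial.X - Polynomial.C (AdjoinRoot.root f)) * q = f.map (AdjoinRoot.of f) :=
    Polynomial.mul_divByMonic_eq_iff_isRoot.mpr (AdjoinRoot.isRoot_root f)
  have : Nontrivial (AdjoinRoot f) :=
    ⟨1, 0, AdjoinRoot.mk_ne_zero_of_natDegree_lt hfm one_ne_zero (by simp [hfd])⟩
  have hqm : q.Monic :=
    (Polynomial.monic_X_sub_C _).of_mul_monic_left (hXq ▸ hfm.map _)
  have hqd : q.natDegree = n := by
    rw [hq, Polynomial.natDegree_divByMonic _ (Polynomial.monic_X_sub_C _),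
      hfm.natDegree_map, hfd, Polynomial.natDegree_X_sub_C, Nat.add_sub_cancel]
  let α : AdjoinRoot f →+* MvPolynomial (Fin n) (Polynomial R) :=
    AdjoinRoot.lift (splitLinearFactor R n).toRingHom (C Polynomial.X) (by
      rw [← Polynomial.eval_map, freeMonic_map_splitLinearFactor]; simp)
  have hcomp : α.comp (AdjoinRoot.of f) = (splitLinearFactor R n).toRingHom :=
    AdjoinRoot.lift_comp_of _
  have hαr : α (AdjoinRoot.root f) = C Polynomial.X := AdjoinRoot.lift_root _
  let _ : Algebra (Polynomial R) (AdjoinRoot f) :=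
    (Polynomial.aeval (R := R) (AdjoinRoot.root f)).toRingHom.toAlgebra
  let β : MvPolynomial (Fin n) (Polynomial R) →ₐ[Polynomial R] AdjoinRoot f :=
    aeval fun j => q.coeff j
  have hβ : (freeMonic (Polynomial R) n).map β.toRingHom = q :=
    Polynomial.freeMonic_map_aeval_coeff hqm hqd
  have hβX : β (C Polynomial.X) = AdjoinRoot.root f :=
    (aeval_C _ _).trans (Polynomial.aeval_X _)
  have hβC (a : R) : β (C (Polynomial.C a)) = AdjoinRoot.of f (C a) :=
    (aeval_C _ _).trans (Polynomial.aeval_C _ _)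
  have hαq : q.map α = freeMonic (Polynomial R) n := by
    apply (Polynomial.monic_X_sub_C (C Polynomial.X)).isRegular.left
    have h := congrArg (Polynomial.map α) hXq
    rwa [Polynomial.map_mul, Polynomial.map_sub, Polynomial.map_X, Polynomial.map_C,
      Polynomial.map_map, hcomp, freeMonic_map_splitLinearFactor, hαr] at h
  have hβα : β.toRingHom.comp α = RingHom.id _ := by
    refine AdjoinRoot.ringHom_ext (MvPolynomial.ringHom_ext (fun a => ?_) fun j => ?_) ?_
    · have : splitLinearFactor R n (C a) = C (Polynomial.C a) := aeval_C _ _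
      simpa [α, this] using hβC a
    · have h := congrArg (Polynomial.coeff · j) <|
        congrArg (Polynomial.map β.toRingHom) (freeMonic_map_splitLinearFactor R n)
      have hβX' : β.toRingHom (C Polynomial.X) = AdjoinRoot.root f := hβX
      simp only [Polynomial.map_mul, Polynomial.map_sub, Polynomial.map_X, Polynomial.map_C, hβ,
        hβX', hXq, Polynomial.coeff_map] at h
      rw [freeMonic_coeff_fin] at h
      rw [RingHom.comp_assoc, hcomp]
      exact h
    · simp [hαr, hβX]
  have hαβ : α.comp β.toRingHom = RingHom.id _ := by
    refine MvPolynomial.ringHom_ext' (Polynomial.ringHom_ext (fun a => ?_) ?_) fun j => ?_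
    · have : splitLinearFactor R n (C a) = C (Polynomial.C a) := aeval_C _ _
      simpa [hβC, this] using RingHom.congr_fun hcomp (C a)
    · simpa [hβX] using hαr
    · have h := congrArg (Polynomial.coeff · j) hαq
      simp only [Polynomial.coeff_map] at h
      rw [freeMonic_coeff_fin] at h
      simpa [β] using h
  have hα : Function.Bijective α :=
    Function.bijective_iff_has_inverse.mpr
      ⟨β, fun x => RingHom.congr_fun hβα x, fun x => RingHom.congr_fun hαβ x⟩
  have hof : (AdjoinRoot.of f).FaithfullyFlat := by
    have := hfm.free_adjoinRoot
    rw [← AdjoinRoot.algebraMap_eq, RingHom.faithfullyFlat_algebraMap_iff]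
    infer_instance
  rw [← hcomp]
  exact RingHom.FaithfullyFlat.stableUnderComposition _ _ hof (.of_bijective hα)

/-- The map `R[A_0, …, A_{n-1}] → R[X_1, …, X_n]` sending `A_j` to the coefficient of `T ^ j` in
`∏ (T - X_i)`. -/
noncomputable def rootsToCoeffs (R : Type*) [CommRing R] (n : ℕ) :
    MvPolynomial (Fin n) R →ₐ[R] MvPolynomial (Fin n) R :=
  aeval fun j => Polynomial.coeff (∏ i : Fin n, (Polynomial.X - Polynomial.C (X i))) j

theorem freeMonic_map_rootsToCoeffs (R : Type*) [CommRing R] [Nontrivial R] (n : ℕ) :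
    (freeMonic R n).map (rootsToCoeffs R n).toRingHom =
      ∏ i : Fin n, (Polynomial.X - Polynomial.C (X i)) :=
  Polynomial.freeMonic_map_aeval_coeff (Polynomial.monic_prod_X_sub_C _ _) (by
    rw [Polynomial.natDegree_finsetProd_X_sub_C_eq_card, Finset.card_univ, Fintype.card_fin])

/-- The polynomial ring in the roots is faithfully flat over the polynomial ring in the
coefficients. -/
theorem rootsToCoeffs_faithfullyFlat {R : Type*} [CommRing R] [Nontrivial R] (n : ℕ) :
    (rootsToCoeffs R n).toRingHom.FaithfullyFlat := by
  induction n generalizing R with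
  | zero =>
    have : rootsToCoeffs R 0 = AlgHom.id R _ := MvPolynomial.algHom_ext fun i => i.elim0
    rw [this]
    exact .of_bijective Function.bijective_id
  | succ n ih =>
    let e := (renameEquiv R (_root_.finSuccEquiv n)).trans (optionEquivRight R (Fin n))
    let ε : MvPolynomial (Fin (n + 1)) R →+* MvPolynomial (Fin n) (Polynomial R) := e
    have he0 : ε (X 0) = C Polynomial.X := by simp [ε, e]
    have hes (i : Fin n) : ε (X i.succ) = X i := by simp [ε, e]
    have hmap : Polynomial.map ε
        (∏ i : Fin (n + 1), (Polynomial.X - Polynomial.C (X i))) =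
          (Polynomial.X - Polynomial.C (C Polynomial.X)) *
            ∏ i : Fin n, (Polynomial.X - Polynomial.C (X i)) := by
      simp [Fin.prod_univ_succ, Polynomial.map_prod, he0, hes]
    have hcomp : ε.comp (rootsToCoeffs R (n + 1)).toRingHom =
        (rootsToCoeffs (Polynomial R) n).toRingHom.comp (splitLinearFactor R n).toRingHom := by
      refine MvPolynomial.ringHom_ext (fun a => ?_) fun j => ?_
      · have hε : ε (C a) = C (Polynomial.C a) := e.commutes a
        simp [rootsToCoeffs, splitLinearFactor, algebraMap_apply, hε]
      · have h := congrArg (Polynomial.map (rootsToCoeffs (Polynomial R) n).toRingHom)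
          (freeMonic_map_splitLinearFactor R n)
        rw [Polynomial.map_mul, freeMonic_map_rootsToCoeffs, Polynomial.map_sub, Polynomial.map_X,
          Polynomial.map_C, Polynomial.map_map] at h
        have hC : (rootsToCoeffs (Polynomial R) n).toRingHom (C Polynomial.X) = C Polynomial.X :=
          aeval_C _ _
        rw [hC, ← hmap, ← freeMonic_map_rootsToCoeffs, Polynomial.map_map] at h
        have h := congrArg (Polynomial.coeff · j) h
        simp only [Polynomial.coeff_map, freeMonic_coeff_fin] at h
        exact h.symm
    have : (rootsToCoeffs R (n + 1)).toRingHom =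
        (e.symm : MvPolynomial (Fin n) (Polynomial R) →+* MvPolynomial (Fin (n + 1)) R).comp
          ((rootsToCoeffs (Polynomial R) n).toRingHom.comp (splitLinearFactor R n).toRingHom) := by
      rw [← hcomp]
      exact RingHom.ext fun x => (e.symm_apply_apply _).symm
    rw [this]
    exact RingHom.FaithfullyFlat.stableUnderComposition _ _
      (RingHom.FaithfullyFlat.stableUnderComposition _ _ (splitLinearFactor_faithfullyFlat R n) ih)
      (.of_bijective e.symm.bijective)

theorem rootsToCoeffs_X (R : Type*) [CommRing R] (n : ℕ) (j : Fin n) :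
    rootsToCoeffs R n (X j) =
      (-1 : MvPolynomial (Fin n) R) ^ (n - (j : ℕ)) * esymm (Fin n) R (n - (j : ℕ)) := by
  have h := Multiset.prod_X_sub_C_coeff ((Finset.univ : Finset (Fin n)).val.map (X (R := R)))
    (k := j) (by simp)
  rw [Multiset.map_map] at h
  simpa [rootsToCoeffs, esymm_eq_multiset_esymm, Finset.prod] using h

theorem rename_subtypeVal_faithfullyFlat {σ : Type*} (R : Type*) [CommRing R] [Nontrivial R]
    (k : σ) :
    (rename (R := R) (Subtype.val : {j : σ // j ≠ k} → σ)).toRingHom.FaithfullyFlat := by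
  classical
  let e := (optionEquivLeft R {j : σ // j ≠ k}).symm.trans
    (renameEquiv R (Equiv.optionSubtypeNe k))
  have : (rename (R := R) (Subtype.val : {j : σ // j ≠ k} → σ)).toRingHom =
      (e : Polynomial (MvPolynomial {j : σ // j ≠ k} R) →+* MvPolynomial σ R).comp Polynomial.C := by
    refine MvPolynomial.ringHom_ext (fun a => ?_) fun j => ?_ <;> simp [e]
  rw [this]
  refine RingHom.FaithfullyFlat.stableUnderComposition _ _ ?_ (.of_bijective e.bijective)
  exact RingHom.faithfullyFlat_algebraMap_iff.mpr inferInstance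

theorem map_faithfullyFlat {R S : Type u} [CommRing R] [CommRing S] (σ : Type u) {f : R →+* S}
    (hf : f.FaithfullyFlat) : (map (σ := σ) f).FaithfullyFlat := by
  algebraize [f]
  let _ : Algebra (MvPolynomial σ R) (MvPolynomial σ S) := algebraMvPolynomial
  have : Module.FaithfullyFlat R S := hf
  exact RingHom.FaithfullyFlat.isStableUnderBaseChange R S (MvPolynomial σ R) (MvPolynomial σ S)
    (RingHom.faithfullyFlat_algebraMap_iff.mpr this)

theorem height_eq_of_isMaximal {K : Type*} [Field K] (n : ℕ) (M : Ideal (MvPolynomial (Fin n) K))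
    [M.IsMaximal] : M.height = n := by
  induction n with
  | zero =>
    have h := Ideal.height_le_ringKrullDim_of_ne_top (Ideal.IsMaximal.ne_top (I := M) ‹_›)
    simpa using h
  | succ n ih =>
    let e := (finSuccEquiv K n).toRingEquiv
    let P : Ideal (Polynomial (MvPolynomial (Fin n) K)) := M.comap e.symm
    have hP : P.IsMaximal := Ideal.comap_isMaximal_of_equiv e.symm
    have hp : (P.under (MvPolynomial (Fin n) K)).IsMaximal :=
      Polynomial.isMaximal_comap_C_of_isJacobsonRing P
    have : P.LiesOver (P.under (MvPolynomial (Fin n) K)) := ⟨rfl⟩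
    have h := Polynomial.height_eq_height_add_one (P.under (MvPolynomial (Fin n) K)) P
    rw [ih] at h
    have h' : P.height = M.height := RingEquiv.height_comap e.symm M
    rw [← h', h, Nat.cast_succ]

end MvPolynomial

namespace RingTheory.Sequence

theorem IsRegular.map_of_faithfullyFlat {R S : Type*} [CommRing R] [CommRing S] {f : R →+* S}
    (hf : f.FaithfullyFlat) {rs : List R} (h : IsRegular R rs) : IsRegular S (rs.map f) := by
  algebraize [f]
  have : Module.FaithfullyFlat R S := hf
  exact h.of_faithfullyFlat

open Module in
theorem IsWeaklyRegular.supportDim_quotient_add_length_le {R M : Type*} [CommRing R]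
    [AddCommGroup M] [Module R M] [Module.Finite R M] (rs : List R) (h : IsWeaklyRegular M rs) :
    supportDim R (M ⧸ Ideal.ofList rs • (⊤ : Submodule R M)) + rs.length ≤ supportDim R M := by
  induction rs generalizing M with
  | nil =>
    rw [Ideal.ofList_nil, Submodule.bot_smul]
    simpa using (supportDim_eq_of_equiv (Submodule.quotEquivOfEqBot ⊥ rfl)).le
  | cons x rs ih =>
    obtain ⟨hx, hrs⟩ := (isWeaklyRegular_cons_iff M _ _).mp h
    have h1 : supportDim R (QuotSMulTop x M) + 1 ≤ supportDim R M := by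
      apply supportDim_quotSMulTop_succ_le_of_notMem_minimalPrimes
      exact fun _ => hx.notMem_of_mem_minimalPrimes
    have h2 := add_le_add_left (ih hrs) 1
    rw [supportDim_eq_of_equiv (Submodule.quotOfListConsSMulTopEquivQuotSMulTopInner M x _),
      List.length_cons, Nat.cast_succ, ← add_assoc]
    exact h2.trans h1

theorem IsWeaklyRegular.ringKrullDim_quotient_add_length_le {R : Type*} [CommRing R] (rs : List R)
    (h : IsWeaklyRegular R rs) :
    ringKrullDim (R ⧸ Ideal.ofList rs) + rs.length ≤ ringKrullDim R := by
  have eq : Ideal.ofList rs = Ideal.ofList rs • (⊤ : Ideal R) := by simp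
  rw [ringKrullDim_eq_of_ringEquiv (Ideal.quotientEquivAlgOfEq R eq).toRingEquiv,
    ← Module.supportDim_quotient_eq_ringKrullDim, ← Module.supportDim_self_eq_ringKrullDim]
  exact h.supportDim_quotient_add_length_le rs

end RingTheory.Sequence

/-- A complete intersection of `m` equations in affine `n`-space has dimension `n - m`. -/
theorem MvPolynomial.ringKrullDim_quotient_add_length_of_isRegular {K : Type*} [Field K] {n : ℕ}
    {rs : List (MvPolynomial (Fin n) K)}
    (h : RingTheory.Sequence.IsRegular (MvPolynomial (Fin n) K) rs) :
    ringKrullDim (MvPolynomial (Fin n) K ⧸ Ideal.ofList rs) + rs.length = n := by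
  apply le_antisymm
  · simpa using h.toIsWeaklyRegular.ringKrullDim_quotient_add_length_le rs
  · have hne : Ideal.ofList rs ≠ ⊤ := by simpa using h.top_ne_smul.symm
    obtain ⟨M, hM, hle⟩ := Ideal.exists_le_maximal _ hne
    have hdim := Ideal.height_le_ringKrullDim_quotient_add_encard (p := M) {x | x ∈ rs}
      (Ideal.subset_span.trans hle)
    rw [MvPolynomial.height_eq_of_isMaximal n M] at hdim
    have hcard : ({x | x ∈ rs} : Set _).encard ≤ rs.length := by
      classical
      rw [← List.coe_toFinset, Set.encard_coe_eq_coe_finsetCard]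
      exact_mod_cast rs.toFinset_card_le
    refine hdim.trans ?_
    gcongr
    exact_mod_cast hcard

/-- Under hypothesis (H1), the polynomials `R_1, …, R_m` form a regular sequence of
`F_q[X_1, …, X_r]` and the variety they define has dimension `r - m`. -/
theorem substituted_polynomials_regular_sequence
    (Fq K : Type) [Field Fq] [Fintype Fq] [Field K] [Algebra Fq K] [IsAlgClosure Fq K]
    (r m : ℕ) (hm : 1 ≤ m) (hmr : m < r) (k : Fin r)
    (G : Fin m → MvPolynomial {j : Fin r // j ≠ k} Fq)
    -- (H1): `G_1, …, G_m` form a regular sequence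
    (hH1 : RingTheory.Sequence.IsRegular (MvPolynomial {j : Fin r // j ≠ k} Fq) (List.ofFn G))
    -- the polynomials `R_i`, obtained from `G_i` by substituting `(-1)^(r-j) Π_(r-j)` for `A_j`
    (R : Fin m → MvPolynomial (Fin r) Fq)
    (hR : ∀ i, R i = MvPolynomial.aeval
        (fun j : {j : Fin r // j ≠ k} =>
          (-1 : MvPolynomial (Fin r) Fq) ^ (r - (j.1 : ℕ))
            * MvPolynomial.esymm (Fin r) Fq (r - (j.1 : ℕ))) (G i))
    -- the ideal generated by `R_1, …, R_m` in `K[X_1, …, X_r]`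
    (I : Ideal (MvPolynomial (Fin r) K))
    (hI : I = Ideal.span (Set.range fun i =>
        MvPolynomial.map (algebraMap Fq K) (R i))) :
    RingTheory.Sequence.IsRegular (MvPolynomial (Fin r) Fq) (List.ofFn R)
      ∧ ringKrullDim (MvPolynomial (Fin r) K ⧸ I) = ((r - m : ℕ) : WithBot ℕ∞) := by
  let φ := (MvPolynomial.rootsToCoeffs Fq r).toRingHom.comp
    (MvPolynomial.rename (R := Fq) (Subtype.val : {j : Fin r // j ≠ k} → Fin r)).toRingHom
  have hφ : φ.FaithfullyFlat := RingHom.FaithfullyFlat.stableUnderComposition _ _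
    (MvPolynomial.rename_subtypeVal_faithfullyFlat Fq k)
    (MvPolynomial.rootsToCoeffs_faithfullyFlat r)
  have hRφ (i : Fin m) : R i = φ (G i) := by
    rw [hR]
    refine DFunLike.congr_fun (?_ : _ = (MvPolynomial.rootsToCoeffs Fq r).comp
      (MvPolynomial.rename (R := Fq) (Subtype.val : {j : Fin r // j ≠ k} → Fin r))) (G i)
    ext1 j
    simp [MvPolynomial.rootsToCoeffs_X]
  clear_value φ
  have hRlist : (List.ofFn G).map φ = List.ofFn R := by
    rw [List.map_ofFn]
    exact congrArg List.ofFn (funext fun i => (hRφ i).symm)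
  have hreg : RingTheory.Sequence.IsRegular (MvPolynomial (Fin r) Fq) (List.ofFn R) :=
    hRlist ▸ hH1.map_of_faithfullyFlat hφ
  refine ⟨hreg, ?_⟩
  have hK : (MvPolynomial.map (σ := Fin r) (algebraMap Fq K)).FaithfullyFlat :=
    MvPolynomial.map_faithfullyFlat _ (RingHom.faithfullyFlat_algebraMap_iff.mpr inferInstance)
  have hIlist : I = Ideal.ofList ((List.ofFn R).map (MvPolynomial.map (algebraMap Fq K))) := by
    rw [hI, List.map_ofFn, Ideal.ofList]
    congr 1
    ext x
    simp [List.mem_ofFn]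
  have hdim := MvPolynomial.ringKrullDim_quotient_add_length_of_isRegular
    (hreg.map_of_faithfullyFlat hK)
  rw [← hIlist, List.length_map, List.length_ofFn] at hdim
  rw [← ENat.WithBot.add_natCast_cancel (c := m), hdim, ← Nat.cast_add, Nat.sub_add_cancel hmr.le]
end

section
/- Let r ≥ 2, fix k with 0 ≤ k ≤ r−1 and l with 1 ≤ l ≤ r. Let J be the r×r matrix whose (i,j) entry is ∂((−1)^i·Π_i)/∂X_j, and let M_{r−k,l} be the (r−1)×(r−1) matrix obtained from J by deleting the row of index r−k and the column of index l. Then det M_{r−k,l} = (−1)^{r−k−1}·X_l^k·∏_{1≤i<j≤r, i≠l, j≠l}(X_j − X_i). -/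
open MvPolynomial

/-- If a matrix is block triangular for an injective labelling of the indices, its determinant is
the product of the diagonal entries. -/
theorem Matrix.BlockTriangular.det_of_injective {m α S : Type*} [Fintype m] [DecidableEq m]
    [LinearOrder α] [CommRing S] {M : Matrix m m S} {b : m → α} (hM : M.BlockTriangular b)
    (hb : Function.Injective b) : M.det = ∏ i, M i i := by
  rw [hM.det, Finset.prod_image hb.injOn]
  refine Finset.prod_congr rfl fun i _ => ?_
  let _ : Unique { a // b a = b i } := ⟨⟨⟨i, rfl⟩⟩, fun j => Subtype.ext (hb j.property)⟩
  exact Matrix.det_unique _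

section ErasedProducts

variable {S : Type*} [CommRing S]

/-- The product of the linear factors `X - v m` over all `m ≠ j`. -/
noncomputable def erasedProd {n : ℕ} (v : Fin n → S) (j : Fin n) : Polynomial S :=
  ∏ m ∈ Finset.univ.erase j, (Polynomial.X - Polynomial.C (v m))

/-- The matrix whose `j`-th column lists the coefficients of `erasedProd v j`, from degree `n - 1`
down to degree `0`. -/
noncomputable def erasedCoeffMatrix {n : ℕ} (v : Fin n → S) : Matrix (Fin n) (Fin n) S :=
  Matrix.of fun i j => (erasedProd v j).coeff (n - 1 - i)

/-- The matrix of multiplication by `X - c` from polynomials of degree `< n` to polynomials of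
degree `< n + 1`, with respect to the monomials in decreasing order. -/
def mulXSubCMatrix (n : ℕ) (c : S) : Matrix (Fin (n + 1)) (Fin n) S :=
  Matrix.of fun i s => (if i = s.castSucc then 1 else 0) + (if i = s.succ then -c else 0)

theorem natDegree_erasedProd_lt {n : ℕ} (v : Fin n → S) (j : Fin n) :
    (erasedProd v j).natDegree < n := by
  have h : (erasedProd v j).natDegree ≤ (Finset.univ.erase j).card := by
    refine (Polynomial.natDegree_prod_le _ _).trans ?_
    rw [Finset.card_eq_sum_ones]
    exact Finset.sum_le_sum fun m _ => Polynomial.natDegree_X_sub_C_le _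
  have hn := j.pos
  rw [Finset.card_erase_of_mem (Finset.mem_univ j), Finset.card_univ, Fintype.card_fin] at h
  omega

theorem erasedProd_succAbove {n : ℕ} (v : Fin (n + 1) → S) (l : Fin (n + 1)) (j : Fin n) :
    erasedProd v (l.succAbove j) =
      (Polynomial.X - Polynomial.C (v l)) * erasedProd (fun i => v (l.succAbove i)) j := by
  have h : ∀ {k : ℕ} (w : Fin k → S) (a : Fin k), erasedProd w a =
      ∏ m, if m = a then 1 else (Polynomial.X - Polynomial.C (w m)) := by
    intro k w a
    rw [erasedProd, ← Finset.prod_erase (a := a) Finset.univ (by simp)]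
    exact Finset.prod_congr rfl fun m hm => by simp [Finset.ne_of_mem_erase hm]
  rw [h, h, Fin.prod_univ_succAbove _ l]
  simp [(Fin.succAbove_ne l j).symm]

theorem coeff_X_sub_C_mul_eq_sum_mulXSubCMatrix {n : ℕ} (c : S) (q : Polynomial S)
    (hq : q.natDegree < n) (i : Fin (n + 1)) :
    ((Polynomial.X - Polynomial.C c) * q).coeff (n - i) =
      ∑ s : Fin n, mulXSubCMatrix n c i s * q.coeff (n - 1 - s) := by
  have h₁ : ∑ s : Fin n, (if i = s.castSucc then 1 else 0) * q.coeff (n - 1 - s) =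
      (Polynomial.X * q).coeff (n - i) := by
    induction i using Fin.lastCases with
    | last => simp [Fin.ext_iff, fun s : Fin n => s.is_lt.ne']
    | cast i =>
      have : n - (i : ℕ) = n - 1 - i + 1 := by omega
      simp [this]
  have h₂ : ∑ s : Fin n, (if i = s.succ then -c else 0) * q.coeff (n - 1 - s) =
      -(c * q.coeff (n - i)) := by
    induction i using Fin.cases with
    | zero => simp [Polynomial.coeff_eq_zero_of_natDegree_lt hq, Fin.ext_iff]
    | succ i =>
      have : n - ((i : ℕ) + 1) = n - 1 - i := by omega
      simp [this]
  simp only [mulXSubCMatrix, Matrix.of_apply, add_mul, Finset.sum_add_distrib, h₁, h₂]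
  rw [sub_mul, Polynomial.coeff_sub, Polynomial.coeff_C_mul, sub_eq_add_neg]

theorem det_mulXSubCMatrix_submatrix (n : ℕ) (c : S) (p : Fin (n + 1)) :
    ((mulXSubCMatrix n c).submatrix p.succAbove id).det = (-c) ^ (n - p : ℕ) := by
  let b : Fin n → ℤ := fun s => if (s : ℕ) < p then -s else s
  have hb : Function.Injective b := by
    intro s t h
    simp only [b] at h
    ext
    split_ifs at h <;> omega
  have hval : ∀ i : Fin n, (p.succAbove i : ℕ) = if (i : ℕ) < p then (i : ℕ) else i + 1 := by
    intro i
    simp only [Fin.succAbove, Fin.lt_def, Fin.val_castSucc]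
    split_ifs <;> simp
  rw [Matrix.BlockTriangular.det_of_injective (b := b) _ hb]
  · have : ∀ i : Fin n, (mulXSubCMatrix n c).submatrix p.succAbove id i i =
        if (i : ℕ) < p then 1 else -c := by
      intro i
      simp only [mulXSubCMatrix, Matrix.submatrix_apply, Matrix.of_apply, Fin.ext_iff, hval, id,
        Fin.val_castSucc, Fin.val_succ]
      split_ifs <;> first | omega | simp
    simp_rw [this]
    rw [Fin.prod_univ_eq_prod_range (fun i => if i < (p : ℕ) then (1 : S) else -c) n,
      ← Finset.prod_range_mul_prod_Ico _ (Nat.le_of_lt_succ p.is_lt),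
      Finset.prod_congr rfl (fun i hi => if_pos (Finset.mem_range.1 hi)),
      Finset.prod_congr rfl (fun i hi => if_neg (Finset.mem_Ico.1 hi).1.not_gt)]
    simp
  · intro i j hij
    simp only [b] at hij
    simp only [mulXSubCMatrix, Matrix.submatrix_apply, Matrix.of_apply, Fin.ext_iff, hval, id,
        Fin.val_castSucc, Fin.val_succ]
    split_ifs at hij ⊢ <;> first | omega | simp

theorem det_erasedCoeffMatrix_submatrix {n : ℕ} (v : Fin (n + 1) → S) (p l : Fin (n + 1)) :
    ((erasedCoeffMatrix v).submatrix p.succAbove l.succAbove).det =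
      (-v l) ^ (n - p : ℕ) * (erasedCoeffMatrix fun i => v (l.succAbove i)).det := by
  rw [← det_mulXSubCMatrix_submatrix, ← Matrix.det_mul]
  congr 1
  ext i j
  simp only [Matrix.submatrix_apply, Matrix.mul_apply, erasedCoeffMatrix, Matrix.of_apply, id,
    erasedProd_succAbove, Nat.add_sub_cancel]
  exact coeff_X_sub_C_mul_eq_sum_mulXSubCMatrix _ _ (natDegree_erasedProd_lt _ j) _

theorem sum_pow_mul_erasedCoeffMatrix {n : ℕ} (v : Fin n → S) (x : S) (j : Fin n) :
    ∑ i : Fin n, x ^ (n - 1 - i : ℕ) * erasedCoeffMatrix v i j = (erasedProd v j).eval x := by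
  rw [Polynomial.eval_eq_sum_range' (natDegree_erasedProd_lt v j), ← Finset.sum_range_reflect,
    ← Fin.sum_univ_eq_sum_range
      (fun i => (erasedProd v j).coeff (n - 1 - i) * x ^ (n - 1 - i)) n]
  exact Finset.sum_congr rfl fun i _ => mul_comm _ _

theorem det_erasedCoeffMatrix {n : ℕ} (v : Fin n → S) :
    (erasedCoeffMatrix v).det = ∏ i : Fin n, ∏ j ∈ Finset.Ioi i, (v j - v i) := by
  induction n with
  | zero => simp
  | succ n ih =>
    have h := Matrix.det_updateRow_sum (erasedCoeffMatrix v) (Fin.last n)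
      (fun i => v 0 ^ (n - i : ℕ))
    have hrow : ∑ i : Fin (n + 1), v 0 ^ (n - i : ℕ) • erasedCoeffMatrix v i =
        fun j => (erasedProd v j).eval (v 0) := by
      ext j
      simpa using sum_pow_mul_erasedCoeffMatrix v (v 0) j
    have hzero : ∀ j : Fin n, (erasedProd v j.succ).eval (v 0) = 0 := by
      intro j
      simpa using congrArg (Polynomial.eval (v 0)) (erasedProd_succAbove v 0 j)
    have hne : (erasedProd v 0).eval (v 0) = ∏ j : Fin n, (v 0 - v j.succ) := by
      have : Finset.univ.erase (0 : Fin (n + 1)) = Finset.Ioi 0 := by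
        ext j; simp
      simp [erasedProd, this, Polynomial.eval_prod]
    have hsign : ∏ j : Fin n, (v 0 - v j.succ) = (-1) ^ n * ∏ j : Fin n, (v j.succ - v 0) := by
      rw [Finset.prod_congr rfl fun j _ => (neg_sub (v (Fin.succ j)) (v 0)).symm,
        Finset.prod_neg, Finset.card_univ, Fintype.card_fin]
    rw [hrow] at h
    simp only [Fin.val_last, Nat.sub_self, pow_zero, one_smul] at h
    rw [← h, Matrix.det_succ_row _ (Fin.last n), Fin.sum_univ_succ]
    simp only [Matrix.updateRow_self, hzero, mul_zero, zero_mul, Finset.sum_const_zero, add_zero,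
      hne, Matrix.submatrix_updateRow_succAbove, det_erasedCoeffMatrix_submatrix, ih]
    rw [Fin.prod_univ_succ, Fin.prod_Ioi_zero, hsign]
    simp only [Fin.prod_Ioi_succ, Fin.val_last, Nat.sub_self, pow_zero, one_mul, Fin.val_zero,
      add_zero, Fin.succAbove_zero]
    rw [← mul_assoc, ← pow_add, ← two_mul, pow_mul]
    simp

end ErasedProducts

section Jacobian

variable {R : Type*} [CommRing R]

theorem MvPolynomial.pderiv_coeff_erasedProd_X {n : ℕ} (j : Fin n) (d : ℕ) :
    pderiv j ((erasedProd (X : Fin n → MvPolynomial (Fin n) R) j).coeff d) = 0 := by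
  have h : ∀ s : Finset (Fin n), j ∉ s → ∀ d, pderiv j ((∏ m ∈ s,
      (Polynomial.X - Polynomial.C (X m : MvPolynomial (Fin n) R))).coeff d) = 0 := by
    intro s
    induction s using Finset.induction_on with
    | empty =>
      intro _ d
      rw [Finset.prod_empty, Polynomial.coeff_one]
      split_ifs <;> simp
    | insert a s ha ih =>
      intro hj d
      rw [Finset.mem_insert, not_or] at hj
      rw [Finset.prod_insert ha, sub_mul, Polynomial.coeff_sub, Polynomial.coeff_C_mul, map_sub,
        Derivation.leibniz, ih hj.2, pderiv_X_of_ne (Ne.symm hj.1)]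
      cases d with
      | zero => simp
      | succ d => simp [ih hj.2]
  exact h _ (Finset.notMem_erase j _) d

theorem MvPolynomial.pderiv_signed_esymm {n : ℕ} (i j : Fin (n + 1)) :
    pderiv j ((-1 : MvPolynomial (Fin (n + 1)) R) ^ ((i : ℕ) + 1)
      * esymm (Fin (n + 1)) R ((i : ℕ) + 1)) =
      -erasedCoeffMatrix (X : Fin (n + 1) → MvPolynomial (Fin (n + 1)) R) i j := by
  have hcoeff : (-1 : MvPolynomial (Fin (n + 1)) R) ^ ((i : ℕ) + 1)
      * esymm (Fin (n + 1)) R ((i : ℕ) + 1) =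
      ((Polynomial.X - Polynomial.C (X j)) * erasedProd X j).coeff (n - i) := by
    have h := Multiset.prod_X_sub_C_coeff
      (Finset.univ.val.map (X : Fin (n + 1) → MvPolynomial (Fin (n + 1)) R))
      (k := n - i) (by simp; omega)
    have hi : n + 1 - (n - (i : ℕ)) = i + 1 := by omega
    rw [Multiset.map_map] at h
    simp only [Multiset.card_map, Finset.card_val, Finset.card_univ, Fintype.card_fin, hi] at h
    rw [esymm_eq_multiset_esymm, ← h, erasedProd,
      Finset.mul_prod_erase Finset.univ
        (fun m => Polynomial.X - Polynomial.C (X m : MvPolynomial (Fin (n + 1)) R))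
        (Finset.mem_univ j)]
    rfl
  rw [hcoeff, sub_mul, Polynomial.coeff_sub, Polynomial.coeff_C_mul, map_sub, Derivation.leibniz,
    pderiv_coeff_erasedProd_X, pderiv_X_self]
  have hX : pderiv j ((Polynomial.X *
      erasedProd (X : Fin (n + 1) → MvPolynomial (Fin (n + 1)) R) j).coeff (n - i)) = 0 := by
    cases n - (i : ℕ) with
    | zero => simp
    | succ d => simp [pderiv_coeff_erasedProd_X]
  rw [hX]
  simp [erasedCoeffMatrix]

end Jacobian

/-- The product over ordered pairs avoiding `l`, reindexed along `l.succAbove`. -/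
theorem Fin.prod_lt_ne_eq_prod_Ioi_succAbove {M : Type*} [CommMonoid M] {n : ℕ} (l : Fin (n + 1))
    (f : Fin (n + 1) → Fin (n + 1) → M) :
    ∏ p ∈ Finset.univ.filter (fun p : Fin (n + 1) × Fin (n + 1) =>
      p.1 < p.2 ∧ p.1 ≠ l ∧ p.2 ≠ l), f p.1 p.2 =
      ∏ i : Fin n, ∏ j ∈ Finset.Ioi i, f (l.succAbove i) (l.succAbove j) := by
  have hIoi : ∀ i : Fin n, Finset.Ioi i = Finset.univ.filter (i < ·) := by
    intro i; ext; simp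
  rw [Finset.prod_filter, Fintype.prod_prod_type]
  simp [Fin.prod_univ_succAbove _ l, hIoi, Finset.prod_filter]

/-- Proposition (determinant of the maximal minors of the Jacobian of the signed elementary
symmetric polynomials). Here `r = n + 1 ≥ 2`; the Jacobian matrix `J` has `(i, j)` entry
`∂((-1)^{i+1} Π_{i+1})/∂X_j` for `i j : Fin (n+1)` (so rows correspond to `Π_1, …, Π_r` and
columns to `X_1, …, X_r`).  Deleting the row of (1-based) index `r - k` — i.e. the row of
`Fin`-index `n - k` — and the column of (1-based) index `l` — i.e. the column of `Fin`-index
`l - 1` — yields a minor whose determinant is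
`(-1)^{r-k-1} · X_l^k · ∏_{i<j, i≠l, j≠l} (X_j - X_i)`. -/
theorem det_jacobian_minor_signed_esymm (R : Type) [CommRing R] (n : ℕ) (hn : 1 ≤ n)
    (k : ℕ) (hk : k ≤ n) (l : ℕ) (hl : 1 ≤ l) (hl' : l ≤ n + 1) :
    Matrix.det
      ((Matrix.of fun i j : Fin (n + 1) =>
        MvPolynomial.pderiv j
          ((-1 : MvPolynomial (Fin (n + 1)) R) ^ ((i : ℕ) + 1)
            * MvPolynomial.esymm (Fin (n + 1)) R ((i : ℕ) + 1))).submatrix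
        (Fin.succAbove ⟨n - k, by omega⟩) (Fin.succAbove ⟨l - 1, by omega⟩))
      = (-1 : MvPolynomial (Fin (n + 1)) R) ^ (n - k)
          * MvPolynomial.X (⟨l - 1, by omega⟩ : Fin (n + 1)) ^ k
          * ∏ p ∈ Finset.univ.filter (fun p : Fin (n + 1) × Fin (n + 1) =>
              p.1 < p.2 ∧ p.1 ≠ ⟨l - 1, by omega⟩ ∧ p.2 ≠ ⟨l - 1, by omega⟩),
              (MvPolynomial.X p.2 - MvPolynomial.X p.1) := by
  set q : Fin (n + 1) := ⟨l - 1, by omega⟩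
  have hmat : (Matrix.of fun i j : Fin (n + 1) =>
      MvPolynomial.pderiv j
        ((-1 : MvPolynomial (Fin (n + 1)) R) ^ ((i : ℕ) + 1)
          * MvPolynomial.esymm (Fin (n + 1)) R ((i : ℕ) + 1))) =
      -erasedCoeffMatrix (X : Fin (n + 1) → MvPolynomial (Fin (n + 1)) R) := by
    ext1 i j
    exact pderiv_signed_esymm i j
  have hk' : n - (n - k) = k := by omega
  have hsign : (-1 : MvPolynomial (Fin (n + 1)) R) ^ n * (-1) ^ k = (-1) ^ (n - k) := by
    obtain ⟨m, rfl⟩ := Nat.exists_eq_add_of_le' hk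
    rw [Nat.add_sub_cancel, pow_add, mul_assoc, ← pow_add, ← two_mul, pow_mul]
    simp
  rw [hmat, Matrix.submatrix_neg, Pi.neg_apply, Pi.neg_apply, Matrix.det_neg, Fintype.card_fin,
    det_erasedCoeffMatrix_submatrix, det_erasedCoeffMatrix,
    Fin.prod_lt_ne_eq_prod_Ioi_succAbove q fun i j => (X j - X i : MvPolynomial (Fin (n + 1)) R)]
  simp only [hk']
  rw [neg_pow (X q : MvPolynomial (Fin (n + 1)) R), ← hsign]
  ring
end

section
/- Assume hypotheses (H1)–(H6). Then the ideal generated by G_1,…,G_m in the polynomial ring K[A_{r−1},…,A_0] over the algebraic closure K is a prime ideal; in particular the affine variety W ⊂ K^r is absolutely irreducible. -/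
open MvPolynomial Polynomial
open scoped Classical

/-- A surjective endomorphism of a Noetherian ring is injective. -/
theorem IsNoetherianRing.injective_of_surjective_endo {R : Type*} [CommRing R]
    [IsNoetherianRing R] (φ : R →+* R) (hφ : Function.Surjective φ) : Function.Injective φ := by
  have hcoe : ∀ n x, (φ ^ n) x = φ^[n] x := fun n x => by rw [RingHom.coe_pow]
  let f : ℕ →o Ideal R :=
    { toFun := fun n => RingHom.ker (φ ^ n)
      monotone' := monotone_nat_of_le_succ fun n x hx => by
        rw [RingHom.mem_ker, hcoe] at hx ⊢
        rw [Function.iterate_succ_apply', hx, map_zero] }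
  obtain ⟨n, hn⟩ := monotone_stabilizes_iff_noetherian.2 ‹IsNoetherianRing R› f
  rw [injective_iff_map_eq_zero]
  intro x hx
  obtain ⟨y, rfl⟩ := hφ.iterate n x
  have hy : y ∈ f (n + 1) := by
    change y ∈ RingHom.ker (φ ^ (n + 1))
    rw [RingHom.mem_ker, hcoe, Function.iterate_succ_apply', hx]
  rw [← hn (n + 1) n.le_succ] at hy
  rw [← hcoe]
  exact hy

/-- An ideal generated by a set of variables is prime. -/
theorem MvPolynomial.isPrime_span_image_X {σ R : Type*} [CommRing R] [IsDomain R] (s : Set σ) :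
    (Ideal.span (MvPolynomial.X '' s : Set (MvPolynomial σ R))).IsPrime := by
  let ψ : MvPolynomial σ R →ₐ[R] MvPolynomial σ R :=
    MvPolynomial.aeval fun j => if j ∈ s then 0 else MvPolynomial.X j
  have hψ : (Ideal.Quotient.mkₐ R (Ideal.span (MvPolynomial.X '' s))).comp ψ =
      Ideal.Quotient.mkₐ R (Ideal.span (MvPolynomial.X '' s : Set (MvPolynomial σ R))) := by
    refine MvPolynomial.algHom_ext fun j => ?_
    by_cases hj : j ∈ s
    · simpa [ψ, hj] using (Ideal.Quotient.eq_zero_iff_mem.2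
        (Ideal.subset_span (Set.mem_image_of_mem _ hj))).symm
    · simp [ψ, hj]
  have hker : Ideal.span (MvPolynomial.X '' s : Set (MvPolynomial σ R)) = RingHom.ker ψ := by
    apply le_antisymm
    · rw [Ideal.span_le]
      rintro _ ⟨j, hj, rfl⟩
      simp [ψ, RingHom.mem_ker, hj]
    · intro p hp
      rw [← Ideal.Quotient.eq_zero_iff_mem]
      have h := DFunLike.congr_fun hψ p
      rw [AlgHom.comp_apply, (RingHom.mem_ker).1 hp, map_zero] at h
      exact h.symm
  rw [hker]
  exact RingHom.ker_isPrime _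

/-- Polynomials `c i • X (e i) + H i`, where the `e i` are distinct and `H i` only involves
variables larger than `e i`, generate a prime ideal. -/
theorem MvPolynomial.isPrime_span_triangular {σ ι F : Type*} [Finite σ] [LinearOrder σ] [Field F]
    (e : ι → σ) (he : Function.Injective e) (c : ι → F) (hc : ∀ i, c i ≠ 0)
    (H : ι → MvPolynomial σ F) (hH : ∀ i, ∀ j ∈ (H i).vars, e i < j) :
    (Ideal.span (Set.range fun i =>
      MvPolynomial.C (c i) * MvPolynomial.X (e i) + H i)).IsPrime := by
  let g : σ → MvPolynomial σ F := Function.extend e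
    (fun i => MvPolynomial.C (c i) * MvPolynomial.X (e i) + H i) MvPolynomial.X
  have hg : ∀ i, g (e i) = MvPolynomial.C (c i) * MvPolynomial.X (e i) + H i :=
    fun i => he.extend_apply _ _ i
  let φ : MvPolynomial σ F →ₐ[F] MvPolynomial σ F := MvPolynomial.aeval g
  have hφ : ∀ j, φ (MvPolynomial.X j) = g j := fun j => MvPolynomial.aeval_X _ _
  have hX : ∀ j, (MvPolynomial.X j : MvPolynomial σ F) ∈ φ.range := by
    intro j
    induction j using WellFoundedGT.induction with
    | ind j ih =>
      by_cases hj : ∃ i, e i = j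
      · obtain ⟨i, rfl⟩ := hj
        have hHi : H i ∈ φ.range := by
          have h : H i ∈ MvPolynomial.supported F (Set.Ioi (e i)) :=
            MvPolynomial.mem_supported.2 fun j hj => hH i j hj
          rw [MvPolynomial.supported_eq_adjoin_X] at h
          refine Algebra.adjoin_le ?_ h
          rintro _ ⟨j, hj, rfl⟩
          exact ih j hj
        have h : (MvPolynomial.X (e i) : MvPolynomial σ F) = (c i)⁻¹ • (g (e i) - H i) := by
          rw [hg, add_sub_cancel_right, ← MvPolynomial.smul_eq_C_mul, smul_smul,
            inv_mul_cancel₀ (hc i), one_smul]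
        rw [h]
        exact Subalgebra.smul_mem _ (sub_mem (AlgHom.mem_range _ |>.2 ⟨_, hφ _⟩) hHi) _
      · exact ⟨MvPolynomial.X j, (hφ j).trans (Function.extend_apply' _ _ _ hj)⟩
  have hsurj : Function.Surjective φ := by
    rw [← AlgHom.range_eq_top, eq_top_iff, ← MvPolynomial.adjoin_range_X, Algebra.adjoin_le_iff]
    rintro _ ⟨j, rfl⟩
    exact hX j
  have hinj : Function.Injective φ :=
    IsNoetherianRing.injective_of_surjective_endo (φ : MvPolynomial σ F →+* MvPolynomial σ F) hsurj
  have hspan : Ideal.span (Set.range fun i =>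
      MvPolynomial.C (c i) * MvPolynomial.X (e i) + H i) =
      (Ideal.span (MvPolynomial.X '' Set.range e : Set (MvPolynomial σ F))).map
        (AlgEquiv.ofBijective φ ⟨hinj, hsurj⟩) := by
    rw [Ideal.map_span, ← Set.range_comp, ← Set.range_comp]
    congr 2
    funext i
    exact ((hφ (e i)).trans (hg i)).symm
  rw [hspan]
  have := MvPolynomial.isPrime_span_image_X (R := F) (Set.range e)
  exact Ideal.map_isPrime_of_equiv _

/-- If the weighted total degree of `p` is the weight of the variable `j`, then every variable of
`p - c X_j`, with `c` the coefficient of `X_j` in `p`, has weight smaller than `j`. -/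
theorem MvPolynomial.weight_lt_of_mem_vars_sub {σ R : Type*} [CommRing R] (w : σ → ℕ)
    (hw : Function.Injective w) (hw0 : ∀ j, w j ≠ 0) (p : MvPolynomial σ R) (j : σ)
    (hj : MvPolynomial.weightedTotalDegree w p = w j) (l : σ)
    (hl : l ∈ (p - MvPolynomial.C (p.coeff (Finsupp.single j 1)) * MvPolynomial.X j).vars) :
    w l < w j := by
  rw [MvPolynomial.mem_vars_iff_mem_support] at hl
  obtain ⟨s, hs, hls⟩ := hl
  rw [MvPolynomial.mem_support_iff, MvPolynomial.coeff_sub, MvPolynomial.coeff_C_mul,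
    MvPolynomial.coeff_X] at hs
  have hsj : Finsupp.single j 1 ≠ s := by
    rintro rfl
    simp at hs
  rw [if_neg hsj, mul_zero, sub_zero] at hs
  have hle := MvPolynomial.le_weightedTotalDegree w (MvPolynomial.mem_support_iff.2 hs)
  have hadd := Finsupp.weight_sub_single_add (w := w) (Finsupp.mem_support_iff.1 hls)
  by_contra! hlt
  have hlj : l = j := hw (by omega)
  subst hlj
  have h0 : Finsupp.weight w (s - Finsupp.single l 1) = 0 := by omega
  have := Finsupp.nonTorsionWeight_of ℕ w hw0
  rw [Finsupp.weight_eq_zero_iff_eq_zero] at h0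
  apply hsj
  ext t
  have h1 := DFunLike.congr_fun h0 t
  have h2 := Finsupp.mem_support_iff.1 hls
  by_cases ht : l = t
  · subst ht
    simp at h1 ⊢
    omega
  · simp [ht] at h1 ⊢
    omega

/-- Under hypotheses (H1)–(H6), the ideal generated by `G_1, …, G_m` in the polynomial ring
over the algebraic closure `K` is prime; in particular `W` is absolutely irreducible. -/
theorem family_variety_absolutely_irreducible
    (Fq K : Type) [Field Fq] [Fintype Fq] [Field K] [Algebra Fq K] [IsAlgClosure Fq K]
    (r m : ℕ) (hm : 1 ≤ m) (hmr : m < r) (k : Fin r)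
    (G : Fin m → MvPolynomial {j : Fin r // j ≠ k} Fq)
    -- the variety `W ⊆ K^r` of common zeros of `G_1, …, G_m`
    (W : Set (Fin r → K))
    (hW : W = {a | ∀ i, MvPolynomial.eval (fun j : {j : Fin r // j ≠ k} => a j.1)
        (MvPolynomial.map (algebraMap Fq K) (G i)) = 0})
    -- the components of highest weight of `G_1, …, G_m` (for `wt(A_j) = r - j`)
    (Gwt : Fin m → MvPolynomial {j : Fin r // j ≠ k} Fq)
    (hGwt : ∀ i, Gwt i = MvPolynomial.weightedHomogeneousComponent
        (fun j : {j : Fin r // j ≠ k} => r - (j.1 : ℕ))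
        (MvPolynomial.weightedTotalDegree
          (fun j : {j : Fin r // j ≠ k} => r - (j.1 : ℕ)) (G i)) (G i))
    -- (H1): `G_1, …, G_m` form a regular sequence
    (hH1 : RingTheory.Sequence.IsRegular (MvPolynomial {j : Fin r // j ≠ k} Fq) (List.ofFn G))
    -- (H2): the Jacobian of `G_1, …, G_m` has full rank `m` at every point of `W`
    (hH2 : ∀ a ∈ W, Matrix.rank (Matrix.of fun (i : Fin m) (j : {j : Fin r // j ≠ k}) =>
        MvPolynomial.eval (fun j' : {j : Fin r // j ≠ k} => a j'.1)
          (MvPolynomial.pderiv j (MvPolynomial.map (algebraMap Fq K) (G i)))) = m)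
    -- (H3): the highest-weight components also satisfy (H1) and (H2)
    (hH3reg : RingTheory.Sequence.IsRegular (MvPolynomial {j : Fin r // j ≠ k} Fq)
        (List.ofFn Gwt))
    (hH3rank : ∀ a : Fin r → K,
        (∀ i, MvPolynomial.eval (fun j : {j : Fin r // j ≠ k} => a j.1)
          (MvPolynomial.map (algebraMap Fq K) (Gwt i)) = 0) →
        Matrix.rank (Matrix.of fun (i : Fin m) (j : {j : Fin r // j ≠ k}) =>
          MvPolynomial.eval (fun j' : {j : Fin r // j ≠ k} => a j'.1)
            (MvPolynomial.pderiv j (MvPolynomial.map (algebraMap Fq K) (Gwt i)))) = m)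
    -- (H4): the non-squarefree locus in `W` has dimension at most `r - m - 1`
    (hH4 : dimOf K r {a | a ∈ W ∧ ¬ Squarefree (monicOfCoeffs r a)} + 1
        ≤ ((r - m : ℕ) : WithBot ℕ∞))
    -- (H5): dimension at most `r - m - 2`
    (hH5 : dimOf K r
        ({a | a ∈ W ∧ ¬ Squarefree (monicOfCoeffs r a)
            ∧ a ⟨0, lt_of_le_of_lt (Nat.zero_le m) hmr⟩ = 0}
          ∪ {a | a ∈ W ∧ 2 ≤ (EuclideanDomain.gcd (monicOfCoeffs r a)
              (Polynomial.derivative (monicOfCoeffs r a))).degree}) + 2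
        ≤ ((r - m : ℕ) : WithBot ℕ∞))
    -- (H6): the non-squarefree locus of the variety at infinity has dimension `≤ r - m - 1`
    (hH6 : dimOf K r {a | (∀ i, MvPolynomial.eval (fun j : {j : Fin r // j ≠ k} => a j.1)
          (MvPolynomial.map (algebraMap Fq K) (Gwt i)) = 0)
          ∧ ¬ Squarefree (monicOfCoeffs r a)} + 1 ≤ ((r - m : ℕ) : WithBot ℕ∞))
 :
    (Ideal.span (Set.range fun i =>
        MvPolynomial.map (algebraMap Fq K) (MvPolynomial.rename Subtype.val (G i)))).IsPrime := by
  classical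
  set w : {j : Fin r // j ≠ k} → ℕ := fun j => r - (j.1 : ℕ) with hwdef
  have hw : Function.Injective w := by
    intro a b hab
    have := a.1.isLt
    have := b.1.isLt
    exact Subtype.ext (Fin.ext (by simp only [hwdef] at hab; omega))
  have hw0 : ∀ j, w j ≠ 0 := fun j => by
    have := j.1.isLt
    simp only [hwdef]
    omega
  have hcoeff : ∀ i s, (Gwt i).coeff s ≠ 0 →
      Finsupp.weight w s = MvPolynomial.weightedTotalDegree w (G i) ∧
        (Gwt i).coeff s = (G i).coeff s := by
    intro i s hs
    rw [hGwt i, MvPolynomial.coeff_weightedHomogeneousComponent] at hs ⊢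
    split_ifs at hs ⊢ with h
    · exact ⟨h, rfl⟩
    · exact absurd rfl hs
  have hconst : ∀ i, (Gwt i).coeff 0 = 0 := by
    intro i
    by_contra h
    have hC : Gwt i = MvPolynomial.C ((G i).coeff 0) := by
      have hd := (hcoeff i 0 h).1
      rw [map_zero] at hd
      have hG := hGwt i
      rw [← hd] at hG
      exact hG.trans (MvPolynomial.weightedHomogeneousComponent_zero (G i) hw0)
    have hu : IsUnit (Gwt i) := by
      rw [hC, ← (hcoeff i 0 h).2]
      exact (IsUnit.mk0 _ h).map MvPolynomial.C
    apply hH3reg.top_ne_smul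
    have htop : Ideal.ofList (List.ofFn Gwt) = ⊤ :=
      Ideal.eq_top_of_isUnit_mem _
        (Ideal.subset_span (by simp)) hu
    rw [htop, Submodule.top_smul]
  have hrank := hH3rank 0 fun i => by
    change MvPolynomial.eval (0 : {j : Fin r // j ≠ k} → K) _ = 0
    rw [MvPolynomial.eval_zero, MvPolynomial.constantCoeff_eq, MvPolynomial.coeff_map, hconst,
      map_zero]
  set M : Matrix (Fin m) {j : Fin r // j ≠ k} K :=
    Matrix.of fun i j => algebraMap Fq K ((Gwt i).coeff (Finsupp.single j 1)) with hM
  have hMrank : M.rank = m := by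
    convert hrank using 2
    ext i j
    change _ = MvPolynomial.eval (0 : {j : Fin r // j ≠ k} → K) _
    rw [MvPolynomial.eval_zero, MvPolynomial.constantCoeff_eq, MvPolynomial.coeff_pderiv]
    simp [hM, MvPolynomial.coeff_map]
  have hind : LinearIndependent K M.row := by
    rw [linearIndependent_iff_card_eq_finrank_span, Fintype.card_fin]
    exact hMrank.symm.trans M.rank_eq_finrank_span_row
  have hex : ∀ i, ∃ j, (Gwt i).coeff (Finsupp.single j 1) ≠ 0 := by
    intro i
    by_contra! h
    exact hind.ne_zero i (by ext j; simp [hM, h])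
  choose e he using hex
  have hdeg : ∀ i j, (Gwt i).coeff (Finsupp.single j 1) ≠ 0 →
      MvPolynomial.weightedTotalDegree w (G i) = w j := fun i j h => by
    rw [← (hcoeff i _ h).1, Finsupp.weight_single, one_smul]
  have heinj : Function.Injective e := by
    intro i i' hii'
    by_contra hne
    have hrow : ∀ t, e t = e i → M.row t = Pi.single (e i) (M t (e i)) := by
      intro t ht
      ext j
      by_cases hj : j = e i
      · subst hj
        simp
      · rw [Pi.single_eq_of_ne hj]
        by_contra h
        have hne0 : (Gwt t).coeff (Finsupp.single j 1) ≠ 0 := by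
          rintro h0
          exact h (by simp [hM, h0])
        exact hj (hw (by rw [← hdeg t j hne0, hdeg t (e t) (he t), ht]))
    have hpair := (LinearIndepOn.pair_iff M.row hne).1 (hind.linearIndepOn _)
      (M i' (e i)) (-M i (e i)) (by
      rw [hrow i rfl, hrow i' hii'.symm, ← Pi.single_smul, ← Pi.single_smul, ← Pi.single_add]
      simp [mul_comm])
    have h0 := neg_eq_zero.1 hpair.2
    simp only [hM, Matrix.of_apply, map_eq_zero] at h0
    exact he i h0
  have hc : ∀ i, (G i).coeff (Finsupp.single (e i) 1) ≠ 0 := fun i => by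
    rw [← (hcoeff i _ (he i)).2]
    exact he i
  convert MvPolynomial.isPrime_span_triangular (fun i => (e i).1)
    (Subtype.val_injective.comp heinj)
    (fun i => algebraMap Fq K ((G i).coeff (Finsupp.single (e i) 1)))
    (fun i => (_root_.map_ne_zero _).2 (hc i))
    (fun i => MvPolynomial.map (algebraMap Fq K) (MvPolynomial.rename Subtype.val
      (G i - MvPolynomial.C ((G i).coeff (Finsupp.single (e i) 1)) * MvPolynomial.X (e i)))) ?_
    using 4 with i
  · simp
  · intro i j hj
    have hj' := MvPolynomial.vars_rename _ _ (MvPolynomial.vars_map _ _ hj)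
    obtain ⟨l, hl, rfl⟩ := Finset.mem_image.1 hj'
    have hlt := MvPolynomial.weight_lt_of_mem_vars_sub w hw hw0 (G i) (e i)
      (hdeg i _ (he i)) l hl
    simp only [hwdef] at hlt
    exact Fin.lt_def.2 (by omega)
end
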